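/- The cyclotomic Hecke algebra H_{r,p,n}(Q) of type G(r,p,n) has K-basis {L_1^{c_1}⋯L_n^{c_n} T_w : w ∈ S_n, 0 ≤ c_i < r for all i, and c_1 + ⋯ + c_n ≡ 0 (mod p)}. -/

import Mathlib

noncomputable section
namespace HuMathas

open scoped BigOperators
open scoped Classical

/-! ## The Ariki–Koike algebra presentation -/

variable (K : Type) [CommRing K]

/-- The defining relations of the Ariki–Koike algebra `H_{r,n}(Q)` (with `r = p t`),
with generators `T_0, …, T_{n-1}` indexed by `Fin n`. -/
inductive AKRel (q : K) (p : ℕ) {t : ℕ} (Q : Fin t → K) (n : ℕ) :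
    FreeAlgebra K (Fin n) → FreeAlgebra K (Fin n) → Prop
  | cyclo (h0 : 0 < n) :
      AKRel q p Q n
        (((List.finRange t).map (fun k => FreeAlgebra.ι K (⟨0, h0⟩ : Fin n) ^ p - algebraMap K _ (Q k ^ p))).prod) 0
  | braid01 (h1 : 1 < n) :
      AKRel q p Q n
        (FreeAlgebra.ι K (⟨0, by omega⟩ : Fin n) * FreeAlgebra.ι K (⟨1, h1⟩ : Fin n) *
            FreeAlgebra.ι K (⟨0, by omega⟩ : Fin n) * FreeAlgebra.ι K (⟨1, h1⟩ : Fin n))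
        (FreeAlgebra.ι K (⟨1, h1⟩ : Fin n) * FreeAlgebra.ι K (⟨0, by omega⟩ : Fin n) *
            FreeAlgebra.ι K (⟨1, h1⟩ : Fin n) * FreeAlgebra.ι K (⟨0, by omega⟩ : Fin n))
  | quad (i : ℕ) (hi : 1 ≤ i) (hn : i < n) :
      AKRel q p Q n
        ((FreeAlgebra.ι K (⟨i, hn⟩ : Fin n) + 1) *
          (FreeAlgebra.ι K (⟨i, hn⟩ : Fin n) - algebraMap K _ q)) 0
  | braid (i : ℕ) (hi : 1 ≤ i) (hn : i + 1 < n) :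
      AKRel q p Q n
        (FreeAlgebra.ι K (⟨i, by omega⟩ : Fin n) * FreeAlgebra.ι K (⟨i + 1, hn⟩ : Fin n) *
            FreeAlgebra.ι K (⟨i, by omega⟩ : Fin n))
        (FreeAlgebra.ι K (⟨i + 1, hn⟩ : Fin n) * FreeAlgebra.ι K (⟨i, by omega⟩ : Fin n) *
            FreeAlgebra.ι K (⟨i + 1, hn⟩ : Fin n))
  | comm (i j : ℕ) (hij : i + 1 < j) (hj : j < n) :
      AKRel q p Q n
        (FreeAlgebra.ι K (⟨i, by omega⟩ : Fin n) * FreeAlgebra.ι K (⟨j, hj⟩ : Fin n))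
        (FreeAlgebra.ι K (⟨j, hj⟩ : Fin n) * FreeAlgebra.ι K (⟨i, by omega⟩ : Fin n))

/-- The Ariki–Koike algebra `H_{r,n}(Q)` of type `G(r,1,n)` where `r = p * t`,
presented by generators `T_0, …, T_{n-1}` and the relations `AKRel`. -/
def AK (q : K) (p : ℕ) {t : ℕ} (Q : Fin t → K) (n : ℕ) : Type :=
  RingQuot (AKRel K q p Q n)

instance (q : K) (p : ℕ) {t : ℕ} (Q : Fin t → K) (n : ℕ) : Ring (AK K q p Q n) :=
  inferInstanceAs (Ring (RingQuot (AKRel K q p Q n)))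

instance (q : K) (p : ℕ) {t : ℕ} (Q : Fin t → K) (n : ℕ) : Algebra K (AK K q p Q n) :=
  inferInstanceAs (Algebra K (RingQuot (AKRel K q p Q n)))

section ops
variable (q : K) (p : ℕ) {t : ℕ} (Q : Fin t → K) (n : ℕ)

/-- The generator `T_i` of the Ariki–Koike algebra, for `0 ≤ i ≤ n-1` (and junk value `1`
for `i ≥ n`). -/
def Tg (i : ℕ) : AK K q p Q n :=
  if h : i < n then RingQuot.mkAlgHom K (AKRel K q p Q n) (FreeAlgebra.ι K ⟨i, h⟩) else 1

/-- The Murphy elements `L_k` (`1 ≤ k ≤ n`), defined by `L_1 = T_0` and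
`L_{k+1} = q⁻¹ T_k L_k T_k`;  `L_0` is a junk value. -/
def Lm : ℕ → AK K q p Q n
  | 0 => 1
  | 1 => Tg K q p Q n 0
  | (k + 2) => Ring.inverse q • (Tg K q p Q n (k + 1) * Lm (k + 1) * Tg K q p Q n (k + 1))

/-- The product `T_{i_1} ⋯ T_{i_k}` attached to a word `[i_1, …, i_k]`. -/
def Tword (l : List ℕ) : AK K q p Q n := (l.map (Tg K q p Q n)).prod

/-- The simple transposition `s_i = (i, i+1)` of `{1, …, n} ⊆ ℕ` (junk value `1` unless
`1 ≤ i ≤ n - 1`). -/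
def sswap (i : ℕ) : Equiv.Perm ℕ :=
  if 1 ≤ i ∧ i < n then Equiv.swap i (i + 1) else 1

/-- The permutation of `{1, …, n}` attached to a word in the simple transpositions, where the
letters of the word act in order from left to right (i.e. `s_{i_1}` acts first). -/
def wordPerm (l : List ℕ) : Equiv.Perm ℕ := ((l.map (sswap n)).reverse).prod

/-- `w` is a permutation of `{1, …, n} ⊆ ℕ`, i.e. it fixes everything outside `{1, …, n}`. -/
def IsSnPerm (w : Equiv.Perm ℕ) : Prop := ∀ k : ℕ, (k = 0 ∨ n < k) → w k = k

/-- `l` is a reduced word for `w ∈ S_n` in the simple transpositions `s_1, …, s_{n-1}`. -/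
def IsReducedWordFor (w : Equiv.Perm ℕ) (l : List ℕ) : Prop :=
  (∀ i ∈ l, 1 ≤ i ∧ i < n) ∧ wordPerm n l = w ∧
    ∀ l' : List ℕ, ((∀ i ∈ l', 1 ≤ i ∧ i < n) ∧ wordPerm n l' = w) → l.length ≤ l'.length

/-- The element `T_w` for `w ∈ S_n`, defined via a (choice of) reduced word for `w`; this is
well defined because the braid relations hold in the Ariki–Koike algebra. -/
def Tw (w : Equiv.Perm ℕ) : AK K q p Q n :=
  if h : ∃ l : List ℕ, IsReducedWordFor n w l then Tword K q p Q n (Classical.choose h) else 0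

/-- The element `T_w^* = T_{i_k} ⋯ T_{i_1}`, the image of `T_w` under the anti-automorphism `*`
of the Ariki–Koike algebra which fixes each generator `T_i`. -/
def Twstar (w : Equiv.Perm ℕ) : AK K q p Q n :=
  if h : ∃ l : List ℕ, IsReducedWordFor n w l then
    Tword K q p Q n (Classical.choose h).reverse else 0

/-- The monomial `L_1^{c_1} ⋯ L_n^{c_n}` in the Murphy elements. -/
def Lmono (c : ℕ → ℕ) : AK K q p Q n := (((List.range n).map (fun i => Lm K q p Q n (i + 1) ^ c (i + 1))).prod)

/-- The cyclotomic Hecke algebra `H_{r,p,n}(Q)` of type `G(r,p,n)`: the subalgebra of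
`H_{r,n}(Q)` generated by `T_0^p`, `T_0⁻¹ T_1 T_0` and `T_1, …, T_{n-1}`. -/
def AKp : Subalgebra K (AK K q p Q n) :=
  Algebra.adjoin K
    ({Tg K q p Q n 0 ^ p, Ring.inverse (Tg K q p Q n 0) * Tg K q p Q n 1 * Tg K q p Q n 0} ∪
      {x | ∃ i : ℕ, 1 ≤ i ∧ i < n ∧ x = Tg K q p Q n i})

/-- The automorphism `σ` of `H_{r,n}(Q)` with `σ(T_0) = ε T_0` and `σ(T_i) = T_i` for
`i ≥ 1`; it is the unique algebra automorphism with these values on the generators. -/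
def sigmaAut (ε : K) : AK K q p Q n ≃ₐ[K] AK K q p Q n :=
  if h : ∃ f : AK K q p Q n ≃ₐ[K] AK K q p Q n,
      f (Tg K q p Q n 0) = ε • Tg K q p Q n 0 ∧ ∀ i : ℕ, 1 ≤ i → f (Tg K q p Q n i) = Tg K q p Q n i
  then Classical.choose h else AlgEquiv.refl

/-- The automorphism `τ` of `H_{r,n}(Q)` given by `τ(h) = T_0⁻¹ h T_0` (as a function). -/
def tauMap (x : AK K q p Q n) : AK K q p Q n :=
  Ring.inverse (Tg K q p Q n 0) * x * Tg K q p Q n 0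

end ops

end HuMathas
namespace HuMathas

section vb
variable (K : Type) [CommRing K]
variable (q : K) (p : ℕ) {tt : ℕ} (Q : Fin tt → K) (n : ℕ) (κ : ℕ) (t_ : Fin κ → ℕ)

/-- The parameter `Q_k` (1-based indexing, junk value `0` outside `1 ≤ k ≤ t`). -/
def Qat (k : ℕ) : K := if h : 1 ≤ k ∧ k ≤ tt then Q ⟨k - 1, by omega⟩ else 0

/-- `t_α` for `1 ≤ α ≤ κ` (1-based indexing, junk value `0` otherwise). -/
def tat (α : ℕ) : ℕ := if h : 1 ≤ α ∧ α ≤ κ then t_ ⟨α - 1, by omega⟩ else 0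

/-- `t_{1..α} = t_1 + ⋯ + t_α`. -/
def tsum (α : ℕ) : ℕ := ∑ β ∈ Finset.Icc 1 α, tat κ t_ β

/-- The sub-tuple `Q_α = (Q_{t_{1..α-1}+1}, …, Q_{t_{1..α}})` of `Q`. -/
def Qsub (α : ℕ) : Fin (tat κ t_ α) → K :=
  fun i => Qat K Q (tsum κ t_ (α - 1) + i.val + 1)

/-- `Q_i` and `Q_j` lie in the same `(ε,q)`-orbit only if they lie in the same part
`Q_α` of the partition of `Q` determined by `t_`.  (Here `K` must be a field for `zpow`.) -/
def OrbitPartition {K : Type} [Field K] (ε q : K) {tt : ℕ} (Q : Fin tt → K)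
    (κ : ℕ) (t_ : Fin κ → ℕ) : Prop :=
  (tsum κ t_ κ = tt) ∧
  ∀ α β i j : ℕ, 1 ≤ α → α ≤ κ → 1 ≤ β → β ≤ κ →
    tsum κ t_ (α - 1) < i → i ≤ tsum κ t_ α →
    tsum κ t_ (β - 1) < j → j ≤ tsum κ t_ β →
    (∃ a b : ℤ, Qat K Q i = ε ^ a * q ^ b * Qat K Q j) → α = β

variable (b : Fin κ → ℕ)

/-- `b_α` for `1 ≤ α ≤ κ` (1-based indexing, junk value `0` otherwise). -/
def bat (α : ℕ) : ℕ := if h : 1 ≤ α ∧ α ≤ κ then b ⟨α - 1, by omega⟩ else 0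

/-- `b_{1..α} = b_1 + ⋯ + b_α`. -/
def bsum (α : ℕ) : ℕ := ∑ β ∈ Finset.Icc 1 α, bat κ b β

/-- `b_{α..κ} = b_α + ⋯ + b_κ`. -/
def bsumFrom (α : ℕ) : ℕ := ∑ β ∈ Finset.Icc α κ, bat κ b β

/-- `b` is a composition of `n` into `κ` non-negative parts, i.e. `b ∈ Λ(n,κ)`. -/
def IsComp : Prop := bsum κ b κ = n

/-- The word `(s_{a+b-1} ⋯ s_1)^b` representing the permutation `w_{a,b}`. -/
def wabWord (a c : ℕ) : List ℕ :=
  (List.replicate c ((List.range' 1 (a + c - 1)).reverse)).flatten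

/-- The permutation `w_{a,b} = (s_{a+b-1} ⋯ s_1)^b` of `{1, …, n}`. -/
def wabPerm (a c : ℕ) : Equiv.Perm ℕ := wordPerm n (wabWord a c)

/-- `v^+_{a,b}(s) = ∏_{k=1}^{s} (L_1^p - Q_k^p) ⋯ (L_a^p - Q_k^p) · T_{w_{a,b}}`. -/
def vplus (a c s : ℕ) : AK K q p Q n :=
  (((List.range s).map (fun k0 =>
      ((List.range a).map (fun m0 =>
        Lm K q p Q n (m0 + 1) ^ p - algebraMap K _ (Qat K Q (k0 + 1) ^ p))).prod)).prod) *
    Tword K q p Q n (wabWord a c)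

/-- `u^+_{ω_b} = ∏_{α=1}^{κ-1} ∏_{k=t_{1..α}+1}^{t_{1..α+1}} (L_1^p - Q_k^p) ⋯ (L_{b_{1..α}}^p - Q_k^p)`. -/
def uplusOmega : AK K q p Q n :=
  (((List.range (κ - 1)).map (fun α0 =>
      ((List.range (tsum κ t_ (α0 + 2) - tsum κ t_ (α0 + 1))).map (fun k0 =>
        ((List.range (bsum κ b (α0 + 1))).map (fun m0 =>
          Lm K q p Q n (m0 + 1) ^ p -
            algebraMap K _ (Qat K Q (tsum κ t_ (α0 + 1) + k0 + 1) ^ p))).prod)).prod)).prod)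

/-- `v_b^- = ∏_{α=κ}^{2} ∏_{i=1}^{t_{1..α-1}} (L_1^p - Q_i^p) ⋯ (L_{b_α}^p - Q_i^p) ·
T_{w_{b_α, b_{1..α-1}}}`, with `α` decreasing from left to right. -/
def vbMinus : AK K q p Q n :=
  ((List.range (κ - 1)).map (fun idx =>
    vplus K q p Q n (bat κ b (κ - idx)) (bsum κ b (κ - idx - 1)) (tsum κ t_ (κ - idx - 1)))).prod

/-- The element `v_b = v^+_{b_κ, b_{1..κ-1}}(t_{1..κ-1}) ⋯ v^+_{b_2, b_1}(t_1) · u^+_{ω_b}`. -/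
def vb : AK K q p Q n :=
  vbMinus K q p Q n κ t_ b * uplusOmega K q p Q n κ t_ b

/-- The permutation `w_b = w_{b_κ, b_{1..κ-1}} w_{b_{κ-1}, b_{1..κ-2}} ⋯ w_{b_2, b_1}`. -/
def wbPerm : Equiv.Perm ℕ :=
  wordPerm n (((List.range (κ - 1)).map (fun idx =>
    wabWord (bat κ b (κ - idx)) (bsum κ b (κ - idx - 1)))).flatten)

/-- The right ideal `a · H` of `H = H_{r,n}(Q)`, as a submodule for the right regular action
(i.e. as a module over the opposite ring). -/
def rIdeal (a : AK K q p Q n) : Submodule (AK K q p Q n)ᵐᵒᵖ (AK K q p Q n) where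
  carrier := {x | ∃ h : AK K q p Q n, x = a * h}
  add_mem' := by
    rintro x y ⟨h1, rfl⟩ ⟨h2, rfl⟩
    exact ⟨h1 + h2, by rw [mul_add]⟩
  zero_mem' := ⟨0, by rw [mul_zero]⟩
  smul_mem' := by
    rintro c x ⟨h, rfl⟩
    refine ⟨h * c.unop, ?_⟩
    rw [← MulOpposite.op_unop c, op_smul_eq_mul, MulOpposite.unop_op, mul_assoc]

/-- The subspace `v · H_{r,p,n}(Q)` of `H_{r,n}(Q)`, as a `K`-submodule. -/
def vSubmoduleP (v : AK K q p Q n) : Submodule K (AK K q p Q n) :=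
  Submodule.map (LinearMap.mulLeft K v) (Subalgebra.toSubmodule (AKp K q p Q n))

/-- The subspace `v · H_{r,n}(Q)` of `H_{r,n}(Q)`, as a `K`-submodule. -/
def vSubmodule (v : AK K q p Q n) : Submodule K (AK K q p Q n) :=
  LinearMap.range (LinearMap.mulLeft K v)

end vb
end HuMathas

namespace HuMathas
section blockProd
variable (K : Type) [CommRing K] (q : K) (p : ℕ) {tt : ℕ} (Q : Fin tt → K) (n : ℕ)
variable (κ : ℕ) (t_ : Fin κ → ℕ)

/-- The product `∏_{Q_i ∈ Q_α} (L_m^p - Q_i^p)` over the `α`-th part of the partition of `Q`. -/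
def LQblockProd (m α : ℕ) : AK K q p Q n :=
  ((List.range (tat κ t_ α)).map (fun i0 =>
    Lm K q p Q n m ^ p -
      algebraMap K _ (Qat K Q (tsum κ t_ (α - 1) + i0 + 1) ^ p))).prod

end blockProd
end HuMathas

namespace HuMathas

section PolynomialSpans

variable {K B : Type*} [Field K] [Ring B] [Algebra K B]

/-- The submodule `∑_{e < r} x ^ e * N e`. -/
def slices (x : B) (r : ℕ) (N : ℕ → Submodule K B) : Submodule K B where
  carrier := {y | ∃ a : ℕ → B, (∀ e, a e ∈ N e) ∧ y = ∑ e ∈ Finset.range r, x ^ e * a e}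
  zero_mem' := ⟨0, fun e => (N e).zero_mem, by simp⟩
  add_mem' := by
    rintro _ _ ⟨a, ha, rfl⟩ ⟨b, hb, rfl⟩
    exact ⟨a + b, fun e => (N e).add_mem (ha e) (hb e), by
      simp [mul_add, Finset.sum_add_distrib]⟩
  smul_mem' := by
    rintro c _ ⟨a, ha, rfl⟩
    exact ⟨c • a, fun e => (N e).smul_mem c (ha e), by simp [Finset.smul_sum]⟩

theorem pow_mul_mem_slices {x : B} {r : ℕ} {N : ℕ → Submodule K B} {e : ℕ} (he : e < r) {a : B}
    (ha : a ∈ N e) : x ^ e * a ∈ slices x r N := by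
  classical
  refine ⟨fun k => if k = e then a else 0, fun k => ?_, ?_⟩
  · by_cases h : k = e
    · subst h; simpa using ha
    · simp [h]
  · simp [Finset.sum_ite_eq', he]

theorem slices_le {x : B} {r : ℕ} {N : ℕ → Submodule K B} {S : Submodule K B}
    (h : ∀ e < r, ∀ a ∈ N e, x ^ e * a ∈ S) : slices x r N ≤ S := by
  rintro _ ⟨a, ha, rfl⟩
  exact S.sum_mem fun e he => h e (Finset.mem_range.1 he) _ (ha e)

theorem map_mem_slices {x : B} {r : ℕ} {N : ℕ → Submodule K B} {S : Submodule K B} (φ : B →ₗ[K] B)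
    (hφ : ∀ e < r, ∀ a ∈ N e, φ (x ^ e * a) ∈ S) {y : B} (hy : y ∈ slices x r N) : φ y ∈ S :=
  slices_le (S := S.comap φ) hφ hy

/-- The homogeneous elements (modulo `ℓ`) generated by `S`, placed in degree `0`, under left
multiplication by `X 1, …, X m`, placed in degree `1`. -/
inductive IsPolyGen (ℓ : ℕ) (X : ℕ → B) (m : ℕ) (S : Submodule K B) : ZMod ℓ → B → Prop
  | base {s : B} : s ∈ S → IsPolyGen ℓ X m S 0 s
  | zero (d : ZMod ℓ) : IsPolyGen ℓ X m S d 0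
  | add {d : ZMod ℓ} {a b : B} :
      IsPolyGen ℓ X m S d a → IsPolyGen ℓ X m S d b → IsPolyGen ℓ X m S d (a + b)
  | smul {d : ZMod ℓ} {a : B} (c : K) : IsPolyGen ℓ X m S d a → IsPolyGen ℓ X m S d (c • a)
  | mul {d : ZMod ℓ} {a : B} (k : ℕ) : 1 ≤ k → k ≤ m → IsPolyGen ℓ X m S d a →
      IsPolyGen ℓ X m S (d + 1) (X k * a)

/-- The submodule of elements satisfying `IsPolyGen` in degree `d`. -/
def polySpan (ℓ : ℕ) (X : ℕ → B) (m : ℕ) (S : Submodule K B) (d : ZMod ℓ) : Submodule K B where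
  carrier := {a | IsPolyGen ℓ X m S d a}
  zero_mem' := .zero d
  add_mem' := .add
  smul_mem' c _ := .smul c

variable {ℓ : ℕ} {X : ℕ → B} {m : ℕ} {S : Submodule K B}

theorem base_mem_polySpan {s : B} (hs : s ∈ S) : s ∈ polySpan ℓ X m S 0 := IsPolyGen.base hs

theorem mul_mem_polySpan {d d' : ZMod ℓ} {k : ℕ} (h1 : 1 ≤ k) (hk : k ≤ m) (hd : d' = d + 1)
    {a : B} (ha : a ∈ polySpan ℓ X m S d) : X k * a ∈ polySpan ℓ X m S d' := by
  subst hd; exact IsPolyGen.mul k h1 hk ha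

theorem pow_mul_mem_polySpan {d : ZMod ℓ} {k : ℕ} (h1 : 1 ≤ k) (hk : k ≤ m) (e : ℕ)
    {d' : ZMod ℓ} (hd : d' = d + e) {a : B} (ha : a ∈ polySpan ℓ X m S d) :
    X k ^ e * a ∈ polySpan ℓ X m S d' := by
  induction e generalizing d' with
  | zero => simpa [hd] using ha
  | succ e ih =>
    rw [pow_succ', mul_assoc]
    exact mul_mem_polySpan h1 hk (by rw [hd]; push_cast; ring) (ih rfl)

/-- Induction principle: a linear map sends `polySpan` into a family of submodules as soon as it
does so on the generators. -/
theorem polySpan_induction {P : ZMod ℓ → B → Prop} (base : ∀ s ∈ S, P 0 s) (zero : ∀ d, P d 0)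
    (add : ∀ d a b, P d a → P d b → P d (a + b)) (smul : ∀ d (c : K) a, P d a → P d (c • a))
    (mul : ∀ d k a, 1 ≤ k → k ≤ m → a ∈ polySpan ℓ X m S d → P d a → P (d + 1) (X k * a))
    {d : ZMod ℓ} {a : B} (ha : a ∈ polySpan ℓ X m S d) : P d a := by
  induction ha with
  | base h => exact base _ h
  | zero d => exact zero d
  | add _ _ h1 h2 => exact add _ _ _ h1 h2
  | smul c _ h => exact smul _ c _ h
  | mul k h1 hk h ih => exact mul _ k _ h1 hk h ih

/-- A version of `polySpan_induction` for membership of the image under a linear map. -/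
theorem map_mem_of_mem_polySpan {C : Type*} [AddCommGroup C] [Module K C] (φ : B →ₗ[K] C)
    (N : ZMod ℓ → Submodule K C) (base : ∀ s ∈ S, φ s ∈ N 0)
    (mul : ∀ d k a, 1 ≤ k → k ≤ m → a ∈ polySpan ℓ X m S d → φ a ∈ N d → φ (X k * a) ∈ N (d + 1))
    {d : ZMod ℓ} {a : B} (ha : a ∈ polySpan ℓ X m S d) : φ a ∈ N d :=
  polySpan_induction (P := fun d a => φ a ∈ N d) base (fun d => by simp)
    (fun d a b h1 h2 => by simpa using (N d).add_mem h1 h2)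
    (fun d c a h => by simpa using (N d).smul_mem c h) mul ha

theorem polySpan_mono {m' : ℕ} (hm : m ≤ m') {S' : Submodule K B} (hS : S ≤ S') (d : ZMod ℓ) :
    polySpan ℓ X m S d ≤ polySpan ℓ X m' S' d := fun _ ha =>
  map_mem_of_mem_polySpan LinearMap.id (polySpan ℓ X m' S') (fun _ hs => base_mem_polySpan (hS hs))
    (fun _ _ _ h1 hk _ h => mul_mem_polySpan h1 (hk.trans hm) rfl h) ha

theorem polySpan_mul_right {h : B} (hS : ∀ s ∈ S, s * h ∈ S) {d : ZMod ℓ} {a : B}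
    (ha : a ∈ polySpan ℓ X m S d) : a * h ∈ polySpan ℓ X m S d :=
  map_mem_of_mem_polySpan (LinearMap.mulRight K h) (polySpan ℓ X m S)
    (fun s hs => base_mem_polySpan (hS s hs))
    (fun _ k a h1 hk _ h => by
      simpa [mul_assoc] using mul_mem_polySpan h1 hk rfl h) ha

/-- Left multiplication by an element `t` which almost commutes with the `X k`. -/
theorem mul_mem_polySpan_of_cross {t : B} {N : ZMod ℓ → Submodule K B}
    (hS : ∀ s ∈ S, t * s ∈ N 0)
    (hN : ∀ d k a, 1 ≤ k → k ≤ m → a ∈ N d → X k * a ∈ N (d + 1))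
    (hle : ∀ d, polySpan ℓ X m S d ≤ N d)
    (ht : ∀ k, 1 ≤ k → k ≤ m → ∃ k' k'' : ℕ, ∃ c : K, (1 ≤ k' ∧ k' ≤ m) ∧ (1 ≤ k'' ∧ k'' ≤ m) ∧
      t * X k = X k' * t + c • X k'')
    {d : ZMod ℓ} {a : B} (ha : a ∈ polySpan ℓ X m S d) : t * a ∈ N d :=
  map_mem_of_mem_polySpan (LinearMap.mulLeft K t) N hS
    (fun d k a h1 hk ha h => by
      obtain ⟨k', k'', c, ⟨h1', hk'⟩, ⟨h1'', hk''⟩, e⟩ := ht k h1 hk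
      simp only [LinearMap.mulLeft_apply] at h ⊢
      rw [← mul_assoc, e, add_mul, smul_mul_assoc, mul_assoc]
      exact (N _).add_mem (hN _ _ _ h1' hk' h)
        ((N _).smul_mem _ (hN _ _ _ h1'' hk'' (hle _ ha)))) ha

theorem exists_mem_slices_of_mem_polySpan_succ
    (hX : ∀ k, 1 ≤ k → k ≤ m → X k * X (m + 1) = X (m + 1) * X k) {d : ZMod ℓ} {a : B}
    (ha : a ∈ polySpan ℓ X (m + 1) S d) :
    ∃ L, a ∈ slices (X (m + 1)) L (fun e => polySpan ℓ X m S (d - e)) := by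
  have hmono : ∀ {d : ZMod ℓ} {L L' : ℕ}, L ≤ L' →
      slices (X (m + 1)) L (fun e => polySpan ℓ X m S (d - e)) ≤
        slices (X (m + 1)) L' (fun e => polySpan ℓ X m S (d - e)) := fun hL =>
    slices_le fun e he a ha => pow_mul_mem_slices (he.trans_le hL) ha
  refine polySpan_induction (P := fun (d : ZMod ℓ) a =>
    ∃ L, a ∈ slices (X (m + 1)) L (fun e => polySpan ℓ X m S (d - e))) ?_ ?_ ?_ ?_ ?_ ha
  · intro s hs
    refine ⟨1, ?_⟩
    simpa using pow_mul_mem_slices (x := X (m + 1)) (r := 1) (e := 0)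
      (N := fun e => polySpan ℓ X m S (0 - e)) (by simp) (a := s)
      (by simpa using base_mem_polySpan hs)
  · exact fun d => ⟨0, Submodule.zero_mem _⟩
  · rintro d a b ⟨L, hL⟩ ⟨L', hL'⟩
    exact ⟨max L L', Submodule.add_mem _ (hmono (le_max_left _ _) hL)
      (hmono (le_max_right _ _) hL')⟩
  · rintro d c a ⟨L, hL⟩
    exact ⟨L, Submodule.smul_mem _ _ hL⟩
  · rintro d k a h1 hk - ⟨L, b, hb, rfl⟩
    refine ⟨L + 1, ?_⟩
    rw [Finset.mul_sum]
    refine Submodule.sum_mem _ fun e he => ?_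
    rw [Finset.mem_range] at he
    rcases Nat.lt_or_ge k (m + 1) with hlt | hge
    · have hc : X k * X (m + 1) ^ e = X (m + 1) ^ e * X k :=
        ((show Commute (X k) (X (m + 1)) from hX k h1 (by omega)).pow_right e).eq
      rw [← mul_assoc, hc, mul_assoc]
      exact pow_mul_mem_slices (by omega) (mul_mem_polySpan h1 (by omega) (by ring) (hb e))
    · obtain rfl : k = m + 1 := by omega
      rw [← mul_assoc, ← pow_succ']
      exact pow_mul_mem_slices (by omega) (by simpa using hb e)

end PolynomialSpans

section HeckeRelations

variable {K B : Type*} [Field K] [Ring B] [Algebra K B]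

/-- The relations of the Iwahori–Hecke algebra of `S_n`, for the elements `T 1, …, T (n - 1)`. -/
structure IsHecke (n : ℕ) (q : K) (T : ℕ → B) : Prop where
  quad : ∀ i, 1 ≤ i → i < n → T i * T i = (q - 1) • T i + q • (1 : B)
  braid : ∀ i, 1 ≤ i → i + 1 < n → T i * T (i + 1) * T i = T (i + 1) * T i * T (i + 1)
  comm : ∀ i j, 1 ≤ i → i + 1 < j → j < n → T i * T j = T j * T i

/-- The relations of the affine Hecke algebra, for the elements `T 1, …, T (n - 1)` and
`X 1, …, X n`. -/
structure IsAffineHecke (n : ℕ) (q : K) (X T : ℕ → B) : Prop extends IsHecke n q T where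
  T_X_T : ∀ i, 1 ≤ i → i < n → T i * X i * T i = q • X (i + 1)
  comm_X : ∀ i j, 1 ≤ i → i ≤ n → 1 ≤ j → j ≤ n → X i * X j = X j * X i
  comm_T : ∀ i k, 1 ≤ i → i < n → 1 ≤ k → k ≤ n → k ≠ i → k ≠ i + 1 → T i * X k = X k * T i

/-- The elements `T_i ⋯ T_1 f T_1 ⋯ T_i`. -/
def conjSeq (T : ℕ → B) (f : B) : ℕ → B
  | 0 => f
  | i + 1 => T (i + 1) * conjSeq T f i * T (i + 1)

variable {n : ℕ} {q : K} {X T : ℕ → B} {f : B}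

theorem IsHecke.commute (hT : IsHecke n q T) {i j : ℕ} (hi : 1 ≤ i) (hin : i < n) (hj : 1 ≤ j)
    (hjn : j < n) (h1 : i ≠ j + 1) (h2 : j ≠ i + 1) : Commute (T i) (T j) := by
  rcases lt_trichotomy i j with h | rfl | h
  · exact hT.comm i j hi (by omega) hjn
  · exact Commute.refl _
  · exact (hT.comm j i hj (by omega) hin).symm

theorem IsHecke.commute_conjSeq (hT : IsHecke n q T)
    (hf : ∀ j, 2 ≤ j → j < n → Commute (T j) f) (i : ℕ) :
    ∀ j, i < n → 1 ≤ j → j < n → j ≠ i → j ≠ i + 1 → Commute (T j) (conjSeq T f i) := by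
  induction i using Nat.strong_induction_on with
  | _ i ih =>
    intro j hi hj hjn h1 h2
    match i with
    | 0 => exact hf j (by omega) hjn
    | i + 1 =>
      by_cases hji : j = i
      · subst hji
        match j with
        | j + 1 =>
          have hc := (ih j (by omega) (j + 2) (by omega) (by omega) (by omega) (by omega)
            (by omega)).eq
          have hb := hT.braid (j + 1) (by omega) hi
          simp only [conjSeq]
          change _ * _ = _ * _
          simp only [Nat.add_assoc, Nat.reduceAdd] at hb ⊢
          calc T (j + 1) * (T (j + 2) * (T (j + 1) * conjSeq T f j * T (j + 1)) * T (j + 2))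
              = (T (j + 1) * T (j + 2) * T (j + 1)) * conjSeq T f j * T (j + 1) * T (j + 2) := by
                noncomm_ring
            _ = T (j + 2) * T (j + 1) * (T (j + 2) * conjSeq T f j) * T (j + 1) * T (j + 2) := by
                rw [hb]; noncomm_ring
            _ = T (j + 2) * T (j + 1) * conjSeq T f j * (T (j + 1) * T (j + 2) * T (j + 1)) := by
                rw [hc, hb]; noncomm_ring
            _ = _ := by noncomm_ring
      · have h3 : Commute (T j) (T (i + 1)) := hT.commute hj hjn (by omega) (by omega) h2 (by omega)
        exact (h3.mul_right (ih i (by omega) j (by omega) hj hjn hji h1)).mul_right h3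

theorem conjSeq_eq_smul (hrec : ∀ i, 1 ≤ i → i < n → T i * X i * T i = q • X (i + 1)) (i : ℕ)
    (hi : i < n) : conjSeq T (X 1) i = q ^ i • X (i + 1) := by
  induction i with
  | zero => simp [conjSeq]
  | succ i ih =>
    rw [conjSeq, ih (by omega), mul_smul_comm, smul_mul_assoc, hrec (i + 1) (by omega) hi,
      smul_smul,
      pow_succ]

/-- The affine Hecke relations follow from those of the type `B` presentation. -/
theorem IsHecke.isAffineHecke (hT : IsHecke n q T) (hq : q ≠ 0)
    (hrec : ∀ i, 1 ≤ i → i < n → T i * X i * T i = q • X (i + 1))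
    (hcomm : ∀ j, 2 ≤ j → j < n → Commute (T j) (X 1))
    (hbraid : 1 < n → X 1 * T 1 * X 1 * T 1 = T 1 * X 1 * T 1 * X 1) :
    IsAffineHecke n q X T := by
  have hX : ∀ i, i < n → X (i + 1) = (q ^ i)⁻¹ • conjSeq T (X 1) i := fun i hi => by
    rw [conjSeq_eq_smul hrec i hi, smul_smul, inv_mul_cancel₀ (pow_ne_zero _ hq), one_smul]
  have hTC := hT.commute_conjSeq hcomm
  have h0 : ∀ j, 1 ≤ j → j < n → Commute (X 1) (conjSeq T (X 1) j) := by
    intro j hj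
    induction j, hj using Nat.le_induction with
    | base =>
      intro h
      change _ * _ = _ * _
      simpa [conjSeq, mul_assoc] using hbraid h
    | succ j hj ih =>
      intro h
      have h2 := (hcomm (j + 1) (by omega) h).symm
      exact (h2.mul_right (ih (by omega))).mul_right h2
  have hCC : ∀ i j, i < j → j < n → Commute (conjSeq T (X 1) i) (conjSeq T (X 1) j) := by
    intro i
    induction i with
    | zero => exact fun j h1 h2 => h0 j h1 h2
    | succ i ih =>
      intro j h1 h2
      have h3 := hTC j (i + 1) h2 (by omega) (by omega) (by omega) (by omega)
      exact (h3.mul_left (ih j (by omega) h2)).mul_left h3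
  have hXX : ∀ i j, 1 ≤ i → i < j → j ≤ n → Commute (X i) (X j) := by
    intro i j hi hij hj
    obtain ⟨i, rfl⟩ : ∃ a, i = a + 1 := ⟨i - 1, by omega⟩
    obtain ⟨j, rfl⟩ : ∃ a, j = a + 1 := ⟨j - 1, by omega⟩
    rw [hX i (by omega), hX j (by omega)]
    exact ((hCC i j (by omega) (by omega)).smul_left _).smul_right _
  refine ⟨hT, hrec, fun i j hi hin hj hjn => ?_, fun i k hi hin hk hkn h1 h2 => ?_⟩
  · rcases lt_trichotomy i j with h | rfl | h
    · exact hXX i j hi h hjn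
    · rfl
    · exact (hXX j i hj h hin).symm
  · obtain ⟨k, rfl⟩ : ∃ a, k = a + 1 := ⟨k - 1, by omega⟩
    rw [hX k (by omega)]
    exact ((hTC k i (by omega) hi hin (by omega) (by omega)).smul_right _).eq

namespace IsAffineHecke

variable (hA : IsAffineHecke n q X T) (hq : q ≠ 0)
include hA

theorem comm_conjSeq_X (hf : ∀ k, 1 ≤ k → k ≤ n → Commute (X k) f) {i k : ℕ} (hik : i + 1 < k)
    (hk : k ≤ n) : Commute (X k) (conjSeq T f i) := by
  induction i with
  | zero => exact hf k (by omega) hk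
  | succ i ih =>
    have h : Commute (X k) (T (i + 1)) :=
      (hA.comm_T (i + 1) k (by omega) (by omega) (by omega) hk (by omega) (by omega)).symm
    exact (h.mul_right (ih (by omega))).mul_right h

include hq

theorem T_mul_X {i : ℕ} (hi : 1 ≤ i) (hin : i < n) :
    T i * X i = X (i + 1) * T i - (q - 1) • X (i + 1) := by
  have h1 := hA.T_X_T i hi hin
  have h2 := hA.quad i hi hin
  have : q • (X (i + 1) * T i) = q • (T i * X i + (q - 1) • X (i + 1)) := by
    rw [← smul_mul_assoc, ← h1, mul_assoc, h2, mul_add, mul_smul_comm, mul_smul_comm, mul_one, h1,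
      smul_add, smul_comm q (q - 1), add_comm]
  rw [smul_right_injective B hq this]
  abel

theorem T_mul_X_succ {i : ℕ} (hi : 1 ≤ i) (hin : i < n) :
    T i * X (i + 1) = X i * T i + (q - 1) • X (i + 1) := by
  have h1 := hA.T_X_T i hi hin
  have h2 := hA.quad i hi hin
  have : q • (T i * X (i + 1)) = q • (X i * T i + (q - 1) • X (i + 1)) := by
    rw [← mul_smul_comm, ← h1, mul_assoc, ← mul_assoc, h2, add_mul, smul_mul_assoc, smul_mul_assoc,
      one_mul, ← mul_assoc, h1, smul_add, smul_comm q (q - 1), add_comm]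
  exact smul_right_injective B hq this

theorem T_mul_X_pow {i : ℕ} (hi : 1 ≤ i) (hin : i < n) (e : ℕ) (b : B) :
    T i * (X i ^ e * b) = X (i + 1) ^ e * (T i * b) -
      (q - 1) • ∑ j ∈ Finset.range e, X (i + 1) ^ (j + 1) * (X i ^ (e - (j + 1)) * b) := by
  induction e with
  | zero => simp
  | succ e ih =>
    rw [pow_succ', mul_assoc, ← mul_assoc, hA.T_mul_X hq hi hin, sub_mul, mul_assoc, ih,
      Finset.sum_range_succ', mul_sub, smul_add, mul_smul_comm, Finset.mul_sum, pow_succ',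
      smul_mul_assoc, sub_add_eq_sub_sub]
    simp only [← mul_assoc, ← pow_succ', Nat.add_sub_add_right, zero_add, pow_one,
      Nat.add_sub_cancel]

/-- The relation needed to move `T j` past `X k` inside `X 1, …, X m`. -/
theorem cross {m : ℕ} (hm : m ≤ n) {j : ℕ} (hj : 1 ≤ j) (hjn : j < n) (hjm : j ≠ m) {k : ℕ}
    (hk : 1 ≤ k) (hkm : k ≤ m) : ∃ k' k'' : ℕ, ∃ c : K, (1 ≤ k' ∧ k' ≤ m) ∧ (1 ≤ k'' ∧ k'' ≤ m) ∧
      T j * X k = X k' * T j + c • X k'' := by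
  by_cases h1 : k = j
  · subst h1
    exact ⟨k + 1, k + 1, -(q - 1), by omega, by omega, by
      rw [hA.T_mul_X hq hj hjn, neg_smul, sub_eq_add_neg]⟩
  by_cases h2 : k = j + 1
  · subst h2
    exact ⟨j, j + 1, q - 1, by omega, by omega, hA.T_mul_X_succ hq hj hjn⟩
  · exact ⟨k, k, 0, by omega, by omega, by
      rw [zero_smul, add_zero, hA.comm_T j k hj hjn hk (by omega) h1 h2]⟩

end IsAffineHecke

end HeckeRelations

section Truncation

variable {K B : Type*} [Field K] [Ring B] [Algebra K B]

/-- The finite Hecke algebra inside `B`, as a submodule. -/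
def heckeSpan (K : Type*) {B : Type*} [Field K] [Ring B] [Algebra K B] (n : ℕ) (T : ℕ → B) :
    Submodule K B :=
  Subalgebra.toSubmodule (Algebra.adjoin K {x | ∃ i, 1 ≤ i ∧ i < n ∧ x = T i})

theorem one_mem_heckeSpan (n : ℕ) (T : ℕ → B) : (1 : B) ∈ heckeSpan K n T :=
  Subalgebra.one_mem _

theorem mul_mem_heckeSpan {n : ℕ} {T : ℕ → B} {a b : B} (ha : a ∈ heckeSpan K n T)
    (hb : b ∈ heckeSpan K n T) : a * b ∈ heckeSpan K n T :=
  Subalgebra.mul_mem _ ha hb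

theorem T_mem_heckeSpan {n : ℕ} {T : ℕ → B} {i : ℕ} (hi : 1 ≤ i) (hin : i < n) :
    T i ∈ heckeSpan K n T :=
  Algebra.subset_adjoin ⟨i, hi, hin, rfl⟩

/-- The span of `X_1^{c_1} ⋯ X_m^{c_m} h` with `c_i < r`, `∑ c_i = d` modulo `ℓ`, and `h` in the
finite Hecke algebra. -/
def truncSpan (K : Type*) {B : Type*} [Field K] [Ring B] [Algebra K B] (n : ℕ) (X T : ℕ → B)
    (ℓ r : ℕ) : ℕ → ZMod ℓ → Submodule K B
  | 0, d => polySpan ℓ X 0 (heckeSpan K n T) d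
  | m + 1, d => slices (X (m + 1)) r (fun e => truncSpan K n X T ℓ r m (d - e))

theorem mul_mem_slices_of_commute {x y : B} (hxy : Commute x y) {r : ℕ}
    {N N' : ℕ → Submodule K B} (hN : ∀ e < r, ∀ a ∈ N e, x * a ∈ N' e) {z : B}
    (hz : z ∈ slices y r N) : x * z ∈ slices y r N' :=
  map_mem_slices (LinearMap.mulLeft K x) (fun e he a ha => by
    rw [LinearMap.mulLeft_apply, ← mul_assoc, (hxy.pow_right e).eq, mul_assoc]
    exact pow_mul_mem_slices he (hN e he a ha)) hz

theorem mul_mem_slices_right {y h : B} {r : ℕ} {N N' : ℕ → Submodule K B}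
    (hN : ∀ e < r, ∀ a ∈ N e, a * h ∈ N' e) {z : B} (hz : z ∈ slices y r N) :
    z * h ∈ slices y r N' :=
  map_mem_slices (LinearMap.mulRight K h) (fun e he a ha => by
    rw [LinearMap.mulRight_apply, mul_assoc]
    exact pow_mul_mem_slices he (hN e he a ha)) hz

theorem slices_mono {x : B} {r r' : ℕ} (hr : r ≤ r') {N N' : ℕ → Submodule K B}
    (hN : ∀ e < r, N e ≤ N' e) : slices x r N ≤ slices x r' N' :=
  slices_le fun e he _ ha => pow_mul_mem_slices (he.trans_le hr) (hN e he ha)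

namespace IsAffineHecke

variable {n : ℕ} {q : K} {X T : ℕ → B} (hA : IsAffineHecke n q X T) (hq : q ≠ 0)

local notation "𝓗" => heckeSpan K n T

section
include hA

theorem commute_X {i j : ℕ} (hi : 1 ≤ i) (hin : i ≤ n) (hj : 1 ≤ j) (hjn : j ≤ n) :
    Commute (X i) (X j) := hA.comm_X i j hi hin hj hjn

include hq

theorem T_mul_mem_polySpan {ℓ m : ℕ} (hm : m ≤ n) {j : ℕ} (hj : 1 ≤ j) (hjn : j < n)
    (hjm : j ≠ m) {S : Submodule K B} (hS : ∀ s ∈ S, T j * s ∈ S) {d : ZMod ℓ} {a : B}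
    (ha : a ∈ polySpan ℓ X m S d) : T j * a ∈ polySpan ℓ X m S d :=
  mul_mem_polySpan_of_cross (fun s hs => base_mem_polySpan (hS s hs))
    (fun _ _ _ h1 hk h => mul_mem_polySpan h1 hk rfl h) (fun _ => le_rfl)
    (fun _ hk hkm => hA.cross hq hm hj hjn hjm hk hkm) ha

theorem T_mul_mem {ℓ m : ℕ} (hm : m ≤ n) {j : ℕ} (hj : 1 ≤ j) (hjn : j < n)
    (hjm : j ≠ m) {d : ZMod ℓ} {a : B} (ha : a ∈ polySpan ℓ X m 𝓗 d) :
    T j * a ∈ polySpan ℓ X m 𝓗 d :=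
  hA.T_mul_mem_polySpan hq hm hj hjn hjm
    (fun _ hs => mul_mem_heckeSpan (T_mem_heckeSpan hj hjn) hs) ha

/-- `T_m ⋯ T_1 f T_1 ⋯ T_m` is monic in `X_{m+1}` up to the scalar `q ^ m`. -/
theorem conjSeq_sub_mem_slices {ℓ r : ℕ} (hr : 0 < r) (hrℓ : (r : ZMod ℓ) = 0) {f : B}
    (hf : f - X 1 ^ r ∈ slices (X 1) r (fun e => polySpan ℓ X 0 𝓗 (-e))) (m : ℕ) (hm : m < n) :
    conjSeq T f m - q ^ m • X (m + 1) ^ r ∈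
      slices (X (m + 1)) r (fun e => polySpan ℓ X m 𝓗 (-e)) := by
  induction m with
  | zero => simpa [conjSeq] using hf
  | succ m ih =>
    set x := X (m + 1) with hx
    set y := X (m + 1 + 1) with hy
    set t := T (m + 1) with ht
    set N : ℕ → Submodule K B := fun e => polySpan ℓ X (m + 1) 𝓗 (-e) with hN
    set g := conjSeq T f m - q ^ m • x ^ r with hg
    have htH : t ∈ 𝓗 := T_mem_heckeSpan (by omega) hm
    have hpow : ∀ (e : ℕ) (b : B), t * (x ^ e * b) = y ^ e * (t * b) -
        (q - 1) • ∑ j ∈ Finset.range e, y ^ (j + 1) * (x ^ (e - (j + 1)) * b) :=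
      hA.T_mul_X_pow hq (by omega) hm
    have hmem : ∀ (e j : ℕ), j + 1 < r → j + 1 ≤ e → ∀ b ∈ polySpan ℓ X (m + 1) 𝓗 (-(e : ZMod ℓ)),
        y ^ (j + 1) * (x ^ (e - (j + 1)) * b) ∈ slices y r N := by
      intro e j hj hje b hb
      refine pow_mul_mem_slices hj (pow_mul_mem_polySpan (by omega) le_rfl _ ?_ hb)
      rw [Nat.cast_sub hje]; ring
    have h1 : t * g * t ∈ slices y r N := by
      refine map_mem_slices ((LinearMap.mulLeft K t).comp (LinearMap.mulRight K t)) ?_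
        (ih (by omega))
        |> fun h => by simpa [mul_assoc] using h
      intro e he a ha
      have hat : a * t ∈ polySpan ℓ X m 𝓗 (-(e : ZMod ℓ)) :=
        polySpan_mul_right (fun s hs => mul_mem_heckeSpan hs htH) ha
      simp only [LinearMap.comp_apply, LinearMap.mulRight_apply, LinearMap.mulLeft_apply, mul_assoc]
      rw [hpow]
      refine Submodule.sub_mem _ (pow_mul_mem_slices he ?_) (Submodule.smul_mem _ _
        (Submodule.sum_mem _ fun j hj => ?_))
      · exact polySpan_mono (by omega) le_rfl _
          (hA.T_mul_mem hq (by omega) (by omega) hm (by omega) hat)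
      · rw [Finset.mem_range] at hj
        exact hmem e j (by omega) (by omega) _ (polySpan_mono (by omega) le_rfl _ hat)
    have h2 : t * x ^ r * t - q • y ^ r ∈ slices y r N := by
      obtain ⟨r, rfl⟩ : ∃ a, r = a + 1 := ⟨r - 1, by omega⟩
      have : t * x ^ (r + 1) * t - q • y ^ (r + 1) =
          -((q - 1) • ∑ j ∈ Finset.range r, y ^ (j + 1) * (x ^ (r + 1 - (j + 1)) * t)) := by
        rw [mul_assoc, hpow, Finset.sum_range_succ, hA.quad (m + 1) (by omega) hm, Nat.sub_self,
          pow_zero, one_mul, mul_add, mul_smul_comm, mul_smul_comm, mul_one, smul_add]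
        abel
      rw [this]
      refine Submodule.neg_mem _ (Submodule.smul_mem _ _ (Submodule.sum_mem _ fun j hj => ?_))
      rw [Finset.mem_range] at hj
      refine hmem (r + 1) j (by omega) (by omega) t ?_
      rw [hrℓ, neg_zero]
      exact base_mem_polySpan htH
    have : conjSeq T f (m + 1) - q ^ (m + 1) • y ^ r =
        t * g * t + q ^ m • (t * x ^ r * t - q • y ^ r) := by
      rw [conjSeq, hg, mul_sub, sub_mul, smul_sub, smul_smul, pow_succ, mul_smul_comm,
        smul_mul_assoc]
      abel
    rw [this]
    exact Submodule.add_mem _ h1 (Submodule.smul_mem _ _ h2)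

/-- If `T_m ⋯ T_1 f T_1 ⋯ T_m = 0`, powers of `X_{m+1}` beyond `r` can be reduced. -/
theorem pow_mul_mem_slices_of_conjSeq_eq_zero {ℓ r : ℕ} {f : B} {m : ℕ} (hm : m < n)
    (hf : conjSeq T f m - q ^ m • X (m + 1) ^ r ∈
      slices (X (m + 1)) r (fun e => polySpan ℓ X m 𝓗 (-e)))
    (h0 : conjSeq T f m = 0) {d : ZMod ℓ} {a : B} (ha : a ∈ polySpan ℓ X m 𝓗 d) :
    X (m + 1) ^ r * a ∈ slices (X (m + 1)) r (fun e => polySpan ℓ X m 𝓗 (d - e)) := by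
  refine map_mem_of_mem_polySpan (LinearMap.mulLeft K (X (m + 1) ^ r))
    (fun d : ZMod ℓ => slices (X (m + 1)) r (fun e => polySpan ℓ X m 𝓗 (d - e))) ?_ ?_ ha
  · intro h hh
    rw [h0, zero_sub] at hf
    have : X (m + 1) ^ r * h = -(q ^ m)⁻¹ • (-(q ^ m • X (m + 1) ^ r) * h) := by
      rw [← neg_smul, smul_mul_assoc, smul_smul, neg_mul_neg, inv_mul_cancel₀ (pow_ne_zero _ hq),
        one_smul]
    rw [LinearMap.mulLeft_apply, this]
    refine Submodule.smul_mem _ _ (mul_mem_slices_right (fun e _ a ha => ?_) hf)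
    rw [zero_sub]
    exact polySpan_mul_right (fun s hs => mul_mem_heckeSpan hs hh) ha
  · intro d k a hk hkm _ h
    have hc := hA.commute_X hk (by omega) (by omega : 1 ≤ m + 1) (by omega)
    rw [LinearMap.mulLeft_apply] at h ⊢
    rw [← mul_assoc, ← (hc.pow_right r).eq, mul_assoc]
    exact mul_mem_slices_of_commute hc
      (fun e _ a ha => mul_mem_polySpan hk hkm (by ring) ha) h

theorem polySpan_succ_le_slices {ℓ r : ℕ} {f : B} {m : ℕ} (hm : m < n)
    (hrℓ : (r : ZMod ℓ) = 0)
    (hf : conjSeq T f m - q ^ m • X (m + 1) ^ r ∈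
      slices (X (m + 1)) r (fun e => polySpan ℓ X m 𝓗 (-e)))
    (h0 : conjSeq T f m = 0) (d : ZMod ℓ) :
    polySpan ℓ X (m + 1) 𝓗 d ≤ slices (X (m + 1)) r (fun e => polySpan ℓ X m 𝓗 (d - e)) := by
  have key : ∀ (k : ℕ) (d' : ZMod ℓ), ∀ a ∈ polySpan ℓ X m 𝓗 d', X (m + 1) ^ k * a ∈
      slices (X (m + 1)) r (fun e => polySpan ℓ X m 𝓗 (d' + k - e)) := by
    intro k
    induction k using Nat.strong_induction_on with
    | _ k ih =>
      intro d' a ha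
      by_cases hk : k < r
      · exact pow_mul_mem_slices hk (by simpa using ha)
      · have h := hA.pow_mul_mem_slices_of_conjSeq_eq_zero hq hm hf h0 ha
        have hpow : X (m + 1) ^ k * a = X (m + 1) ^ (k - r) * (X (m + 1) ^ r * a) := by
          rw [← mul_assoc, ← pow_add]; congr 2; omega
        rw [hpow]
        refine map_mem_slices (LinearMap.mulLeft K (X (m + 1) ^ (k - r))) (fun e he b hb => ?_) h
        rw [LinearMap.mulLeft_apply, ← mul_assoc, ← pow_add]
        have h2 := ih (k - r + e) (by omega) _ b hb
        have h3 : d' - (e : ZMod ℓ) + ((k - r + e : ℕ) : ZMod ℓ) = d' + k := by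
          rw [Nat.cast_add, Nat.cast_sub (by omega : r ≤ k), hrℓ]; ring
        rwa [h3] at h2
  intro a ha
  obtain ⟨L, b, hb, rfl⟩ := exists_mem_slices_of_mem_polySpan_succ
    (fun k hk hkm => hA.comm_X k (m + 1) hk (by omega) (by omega) (by omega)) ha
  refine Submodule.sum_mem _ fun e _ => ?_
  simpa using key e _ _ (hb e)

theorem polySpan_le_truncSpan {ℓ r : ℕ} (hr : 0 < r) (hrℓ : (r : ZMod ℓ) = 0) {f : B}
    (hf : f - X 1 ^ r ∈ slices (X 1) r (fun e => polySpan ℓ X 0 𝓗 (-e))) (h0 : f = 0)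
    (m : ℕ) (hm : m ≤ n) (d : ZMod ℓ) : polySpan ℓ X m 𝓗 d ≤ truncSpan K n X T ℓ r m d := by
  have hz : ∀ i, conjSeq T f i = 0 := fun i => by
    induction i with
    | zero => exact h0
    | succ i ih => simp [conjSeq, ih]
  induction m generalizing d with
  | zero => exact le_rfl
  | succ m ih =>
    exact (hA.polySpan_succ_le_slices hq hm hrℓ
      (hA.conjSeq_sub_mem_slices hq hr hrℓ hf m hm) (hz m) d).trans
      (slices_mono le_rfl fun e _ => ih (by omega) _)

end

end IsAffineHecke

end Truncation

section Independence

variable {K B : Type*} [Field K] [Ring B] [Algebra K B]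

/-- The span of the products of `X 1, …, X m` with elements of `S` on the right. -/
def polyMod (X : ℕ → B) (m : ℕ) (S : Submodule K B) : Submodule K B := polySpan 1 X m S 0

section polyMod

variable {X : ℕ → B} {m : ℕ} {S : Submodule K B}

theorem polySpan_one (d : ZMod 1) : polySpan 1 X m S d = polyMod X m S := by
  rw [polyMod, Subsingleton.elim d 0]

theorem base_mem_polyMod {s : B} (hs : s ∈ S) : s ∈ polyMod X m S := base_mem_polySpan hs

theorem mul_mem_polyMod {k : ℕ} (h1 : 1 ≤ k) (hk : k ≤ m) {a : B} (ha : a ∈ polyMod X m S) :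
    X k * a ∈ polyMod X m S := mul_mem_polySpan h1 hk (Subsingleton.elim _ _) ha

theorem pow_mul_mem_polyMod {k : ℕ} (h1 : 1 ≤ k) (hk : k ≤ m) (e : ℕ) {a : B}
    (ha : a ∈ polyMod X m S) : X k ^ e * a ∈ polyMod X m S :=
  pow_mul_mem_polySpan h1 hk e (Subsingleton.elim _ _) ha

theorem polyMod_mono {m' : ℕ} (hm : m ≤ m') {S' : Submodule K B} (hS : S ≤ S') :
    polyMod X m S ≤ polyMod X m' S' := polySpan_mono hm hS 0

theorem map_mem_of_mem_polyMod {C : Type*} [AddCommGroup C] [Module K C] (φ : B →ₗ[K] C)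
    (N : Submodule K C) (base : ∀ s ∈ S, φ s ∈ N)
    (mul : ∀ k a, 1 ≤ k → k ≤ m → a ∈ polyMod X m S → φ a ∈ N → φ (X k * a) ∈ N)
    {a : B} (ha : a ∈ polyMod X m S) : φ a ∈ N :=
  map_mem_of_mem_polySpan φ (fun _ => N) base
    (fun d k a h1 hk ha h => mul k a h1 hk (by rwa [polySpan_one] at ha) h) ha

theorem exists_mem_slices_of_mem_polyMod_succ
    (hX : ∀ k, 1 ≤ k → k ≤ m → X k * X (m + 1) = X (m + 1) * X k) {a : B}
    (ha : a ∈ polyMod X (m + 1) S) :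
    ∃ L, a ∈ slices (X (m + 1)) L (fun _ => polyMod X m S) := by
  obtain ⟨L, hL⟩ := exists_mem_slices_of_mem_polySpan_succ hX ha
  exact ⟨L, by simpa only [polySpan_one] using hL⟩

theorem polyMod_zero (X : ℕ → B) (S : Submodule K B) : polyMod X 0 S = S :=
  le_antisymm (fun _ ha => map_mem_of_mem_polyMod LinearMap.id S (fun _ hs => hs)
    (fun _ _ _ _ => by omega) ha) (fun _ => base_mem_polyMod)

end polyMod

namespace IsAffineHecke

variable {n : ℕ} {q : K} {X T : ℕ → B} (hA : IsAffineHecke n q X T) (hq : q ≠ 0)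

local notation "𝓗" => heckeSpan K n T

/-- The span of the elements `F_i h` with `i < m` and `h` in the finite Hecke algebra, where
`F_i = T_i ⋯ T_1 f T_1 ⋯ T_i`. -/
def idealBase (K : Type*) {B : Type*} [Field K] [Ring B] [Algebra K B] (n : ℕ) (T : ℕ → B) (f : B)
    (m : ℕ) : Submodule K B :=
  Submodule.span K {y | ∃ i < m, ∃ h ∈ heckeSpan K n T, y = conjSeq T f i * h}

/-- The left span of `idealBase` under `X 1, …, X m`. -/
abbrev idealMod (K : Type*) {B : Type*} [Field K] [Ring B] [Algebra K B] (n : ℕ) (X T : ℕ → B)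
    (f : B) (m : ℕ) : Submodule K B := polyMod X m (idealBase K n T f m)

/-- The left span of `F_m h`, with `h` in the finite Hecke algebra, under `X 1, …, X m'`. -/
abbrev conjMod (K : Type*) {B : Type*} [Field K] [Ring B] [Algebra K B] (n : ℕ) (X T : ℕ → B)
    (f : B) (m m' : ℕ) : Submodule K B :=
  polyMod X m' ((heckeSpan K n T).map (LinearMap.mulLeft K (conjSeq T f m)))

local notation "𝓘" => idealMod K n X T

theorem conjSeq_mul_mem_idealBase {f : B} {m i : ℕ} (hi : i < m) {h : B} (hh : h ∈ 𝓗) :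
    conjSeq T f i * h ∈ idealBase K n T f m := Submodule.subset_span ⟨i, hi, h, hh, rfl⟩

theorem idealBase_le {f : B} {m : ℕ} {N : Submodule K B}
    (h : ∀ i < m, ∀ h ∈ 𝓗, conjSeq T f i * h ∈ N) : idealBase K n T f m ≤ N := by
  refine Submodule.span_le.2 ?_
  rintro _ ⟨i, hi, x, hx, rfl⟩
  exact h i hi x hx

theorem truncSpan_le_polyMod (r m : ℕ) (d : ZMod 1) :
    truncSpan K n X T 1 r m d ≤ polyMod X m 𝓗 := by
  induction m generalizing d with
  | zero => rw [truncSpan, polySpan_one]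
  | succ m ih => exact slices_le fun e _ a ha =>
      pow_mul_mem_polyMod (Nat.succ_pos m) le_rfl e (polyMod_mono (Nat.le_succ m) le_rfl (ih _ ha))

section
include hA hq

theorem T_mul_mem_polyMod {m : ℕ} (hm : m ≤ n) {j : ℕ} (hj : 1 ≤ j) (hjn : j < n)
    (hjm : j ≠ m) {a : B} (ha : a ∈ polyMod X m 𝓗) : T j * a ∈ polyMod X m 𝓗 :=
  hA.T_mul_mem hq hm hj hjn hjm ha

variable {f : B}

omit hA hq in
theorem mul_mem_of_mem_adjoin
    (hf : f ∈ Algebra.adjoin K {X 1}) {N : Submodule K B} (hN : ∀ a ∈ N, X 1 * a ∈ N) {a : B}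
    (ha : a ∈ N) : f * a ∈ N := by
  induction hf using Algebra.adjoin_induction generalizing a with
  | mem x hx => rw [Set.mem_singleton_iff.1 hx]; exact hN a ha
  | algebraMap c => rw [← Algebra.smul_def]; exact N.smul_mem c ha
  | add x y _ _ h1 h2 => rw [add_mul]; exact N.add_mem (h1 ha) (h2 ha)
  | mul x y _ _ h1 h2 => rw [mul_assoc]; exact h1 (h2 ha)

omit hq in
theorem commute_X_adjoin
    (hf : f ∈ Algebra.adjoin K {X 1}) {k : ℕ} (h1 : 1 ≤ k) (hk : k ≤ n) : Commute (X k) f :=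
  Algebra.commute_of_mem_adjoin_singleton_of_commute hf (hA.comm_X k 1 h1 hk le_rfl (by omega))

omit hq in
theorem commute_T_adjoin
    (hf : f ∈ Algebra.adjoin K {X 1}) {j : ℕ} (hj : 2 ≤ j) (hjn : j < n) : Commute (T j) f :=
  Algebra.commute_of_mem_adjoin_singleton_of_commute hf
    (hA.comm_T j 1 (by omega) hjn le_rfl (by omega) (by omega) (by omega))

theorem T_mul_mem_idealBase
    (hf : f ∈ Algebra.adjoin K {X 1}) {m j : ℕ} (hm : m ≤ n) (hj : 1 ≤ j) (hjn : j < n)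
    (hjm : j ≠ m) {s : B}
    (hs : s ∈ idealBase K n T f m) : T j * s ∈ idealBase K n T f m := by
  refine idealBase_le (N := (idealBase K n T f m).comap (LinearMap.mulLeft K (T j))) ?_ hs
  intro i hi h hh
  have hTH : T j ∈ 𝓗 := T_mem_heckeSpan hj hjn
  rw [Submodule.mem_comap, LinearMap.mulLeft_apply]
  have hquad := hA.quad j hj hjn
  by_cases h1 : j = i + 1
  · subst h1
    have : T (i + 1) * (conjSeq T f i * h) = q⁻¹ • (conjSeq T f (i + 1) *
        ((T (i + 1) - (q - 1) • 1) * h)) := by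
      have h2 : conjSeq T f (i + 1) * (T (i + 1) - (q - 1) • 1) =
          q • (T (i + 1) * conjSeq T f i) := by
        rw [conjSeq, mul_assoc _ (T (i + 1)), mul_sub, hquad, mul_smul_comm, mul_one,
          add_sub_cancel_left, mul_smul_comm, mul_one]
      rw [← mul_assoc (conjSeq T f (i + 1)), h2, smul_mul_assoc, smul_smul, inv_mul_cancel₀ hq,
        one_smul, mul_assoc]
    rw [this]
    refine Submodule.smul_mem _ _ (conjSeq_mul_mem_idealBase (by omega) (mul_mem_heckeSpan ?_ hh))
    exact Submodule.sub_mem _ hTH (Submodule.smul_mem _ _ (one_mem_heckeSpan n T))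
  by_cases h2 : j = i
  · subst h2
    obtain ⟨i, rfl⟩ : ∃ a, j = a + 1 := ⟨j - 1, by omega⟩
    have : T (i + 1) * (conjSeq T f (i + 1) * h) =
        (q - 1) • (conjSeq T f (i + 1) * h) + q • (conjSeq T f i * (T (i + 1) * h)) := by
      rw [conjSeq, ← mul_assoc, ← mul_assoc, ← mul_assoc, hquad]
      simp only [add_mul, smul_mul_assoc, one_mul, mul_assoc]
    rw [this]
    exact Submodule.add_mem _ (Submodule.smul_mem _ _ (conjSeq_mul_mem_idealBase hi hh))
      (Submodule.smul_mem _ _ (conjSeq_mul_mem_idealBase (by omega) (mul_mem_heckeSpan hTH hh)))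
  · have hc := hA.toIsHecke.commute_conjSeq (fun j h2 hj => hA.commute_T_adjoin hf h2 hj) i j
      (by omega) hj hjn h2 h1
    rw [← mul_assoc, hc.eq, mul_assoc]
    exact conjSeq_mul_mem_idealBase hi (mul_mem_heckeSpan hTH hh)

theorem T_mul_mem_ideal
    (hf : f ∈ Algebra.adjoin K {X 1}) {m j : ℕ} (hm : m ≤ n) (hj : 1 ≤ j) (hjn : j < n)
    (hjm : j ≠ m) {a : B}
    (ha : a ∈ 𝓘 f m) : T j * a ∈ 𝓘 f m :=
  hA.T_mul_mem_polySpan hq hm hj hjn hjm (fun _ hs => hA.T_mul_mem_idealBase hq hf hm hj hjn hjm hs)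
    ha

theorem conjSeq_mul_mem_ideal
    (hf : f ∈ Algebra.adjoin K {X 1}) {m : ℕ} (hm : m ≤ n) {i : ℕ} (hi : i < m) {a : B}
    (ha : a ∈ polyMod X m 𝓗) : conjSeq T f i * a ∈ 𝓘 f m := by
  induction i generalizing a with
  | zero =>
    refine map_mem_of_mem_polyMod (LinearMap.mulLeft K f) (𝓘 f m)
      (fun s hs => base_mem_polyMod (conjSeq_mul_mem_idealBase hi hs)) (fun k a h1 hk _ h => ?_) ha
    rw [LinearMap.mulLeft_apply, ← mul_assoc, ← (hA.commute_X_adjoin hf h1 (hk.trans hm)).eq,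
      mul_assoc]
    exact mul_mem_polyMod h1 hk h
  | succ i ih =>
    rw [conjSeq, mul_assoc, mul_assoc]
    exact hA.T_mul_mem_ideal hq hf hm (by omega) (by omega) (by omega)
      (ih (by omega) (hA.T_mul_mem_polyMod hq hm (by omega) (by omega) (by omega) ha))

omit hA hq in
theorem conjSeq_mul_mem
    (hf : f ∈ Algebra.adjoin K {X 1}) {m i : ℕ} (hi : i < m) {N : Submodule K B}
    (hX : ∀ a ∈ N, X 1 * a ∈ N)
    (hT : ∀ j, 1 ≤ j → j < m → ∀ a ∈ N, T j * a ∈ N) {a : B} (ha : a ∈ N) :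
    conjSeq T f i * a ∈ N := by
  induction i generalizing a with
  | zero => exact mul_mem_of_mem_adjoin hf hX ha
  | succ i ih =>
    rw [conjSeq, mul_assoc, mul_assoc]
    exact hT _ (by omega) hi _ (ih (by omega) (hT _ (by omega) hi _ ha))

theorem ideal_le
    (hf : f ∈ Algebra.adjoin K {X 1}) {m : ℕ} (hm : m ≤ n) : 𝓘 f m ≤ polyMod X m 𝓗 := by
  intro a ha
  refine map_mem_of_mem_polyMod LinearMap.id _ (fun s hs => ?_)
    (fun k a h1 hk _ h => mul_mem_polyMod h1 hk h) ha
  refine idealBase_le (fun i hi h hh => ?_) hs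
  exact conjSeq_mul_mem hf hi (fun a ha => mul_mem_polyMod le_rfl (by omega) ha)
    (fun j h1 hj a ha => hA.T_mul_mem_polyMod hq hm h1 (by omega) (by omega) ha)
    (base_mem_polyMod hh)

variable {r : ℕ}

theorem conjSeq_mul_mem_polyMod_conjSeq
    (hf : f ∈ Algebra.adjoin K {X 1}) {i m : ℕ} (hi : i < m) (hm : m < n) {a : B}
    (ha : a ∈ conjMod K n X T f m m) : conjSeq T f i * a ∈ conjMod K n X T f m m := by
  refine conjSeq_mul_mem hf hi (fun a ha => mul_mem_polyMod le_rfl (by omega) ha) ?_ ha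
  intro j h1 hj a ha
  refine hA.T_mul_mem_polySpan hq (by omega) h1 (by omega) (by omega) ?_ ha
  rintro _ ⟨h, hh, rfl⟩
  refine ⟨T j * h, mul_mem_heckeSpan (T_mem_heckeSpan h1 (by omega)) hh, ?_⟩
  have hc := hA.toIsHecke.commute_conjSeq (fun j h2 hj => hA.commute_T_adjoin hf h2 hj) m j
      hm h1 (by omega) (by omega) (by omega)
  simp only [LinearMap.mulLeft_apply, ← mul_assoc, hc.eq]

theorem conjSeq_sub_mem
    (hr : 0 < r)
    (hfs : f - X 1 ^ r ∈ slices (X 1) r (fun _ => polyMod X 0 𝓗)) {m : ℕ} (hm : m < n) :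
    conjSeq T f m - q ^ m • X (m + 1) ^ r ∈
    slices (X (m + 1)) r (fun _ => polyMod X m 𝓗) := by
  have := hA.conjSeq_sub_mem_slices hq (ℓ := 1) hr (Subsingleton.elim _ _) (f := f)
    (by simpa only [polySpan_one] using hfs) m hm
  simpa only [polySpan_one] using this

theorem pow_mul_ideal_mem
    (hf : f ∈ Algebra.adjoin K {X 1}) (hr : 0 < r)
    (hfs : f - X 1 ^ r ∈ slices (X 1) r (fun _ => polyMod X 0 𝓗)) {m : ℕ} (hm : m < n) {a : B}
    (ha : a ∈ 𝓘 f m) : X (m + 1) ^ r * a ∈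
    slices (X (m + 1)) r (fun _ => 𝓘 f m) ⊔ conjMod K n X T f m (m + 1) := by
  refine map_mem_of_mem_polyMod (LinearMap.mulLeft K (X (m + 1) ^ r)) _ (fun s hs => ?_)
    (fun k a h1 hk _ h => ?_) ha
  · refine idealBase_le (N := Submodule.comap (LinearMap.mulLeft K (X (m + 1) ^ r))
      (slices (X (m + 1)) r (fun _ => 𝓘 f m) ⊔ conjMod K n X T f m (m + 1))) ?_ hs
    intro i hi h hh
    rw [Submodule.mem_comap, LinearMap.mulLeft_apply]
    set g := conjSeq T f m - q ^ m • X (m + 1) ^ r with hg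
    have hc : Commute (X (m + 1)) (conjSeq T f i) :=
      hA.comm_conjSeq_X (fun k h1 hk => hA.commute_X_adjoin hf h1 hk) (by omega) (by omega)
    have e : X (m + 1) ^ r * (conjSeq T f i * h) =
        -(q ^ m)⁻¹ • (conjSeq T f i * (g * h)) +
          (q ^ m)⁻¹ • (conjSeq T f i * (conjSeq T f m * h)) := by
      rw [add_comm (-(q ^ m)⁻¹ • _), ← mul_assoc, (hc.pow_left r).eq, mul_assoc, hg, neg_smul,
        ← smul_neg, ← smul_add,
        ← mul_neg, ← mul_add, ← neg_mul, ← add_mul, neg_sub, add_sub_cancel, smul_mul_assoc,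
        mul_smul_comm, smul_smul, inv_mul_cancel₀ (pow_ne_zero _ hq), one_smul]
    rw [e]
    refine Submodule.add_mem_sup (Submodule.smul_mem _ _ ?_) (Submodule.smul_mem _ _ ?_)
    · refine mul_mem_slices_of_commute hc.symm (N := fun _ => polyMod X m 𝓗)
        (fun e _ a ha => hA.conjSeq_mul_mem_ideal hq hf (by omega) hi ha) ?_
      refine mul_mem_slices_right (fun e _ a ha => ?_) (hA.conjSeq_sub_mem hq hr hfs hm)
      exact polySpan_mul_right (fun s hs => mul_mem_heckeSpan hs hh) ha
    · refine polyMod_mono (by omega) le_rfl (hA.conjSeq_mul_mem_polyMod_conjSeq hq hf hi hm ?_)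
      exact base_mem_polyMod ⟨h, hh, rfl⟩
  · have hc := hA.commute_X h1 (by omega) (by omega : 1 ≤ m + 1) (by omega)
    rw [LinearMap.mulLeft_apply, ← mul_assoc, ← (hc.pow_right r).eq, mul_assoc]
    obtain ⟨y, hy, z, hz, e⟩ := Submodule.mem_sup.1 h
    rw [LinearMap.mulLeft_apply] at e
    rw [← e, mul_add]
    exact Submodule.add_mem_sup (mul_mem_slices_of_commute hc
      (fun e _ a ha => mul_mem_polyMod h1 hk ha) hy) (mul_mem_polyMod h1 (by omega) hz)

theorem ideal_succ_le
    (hf : f ∈ Algebra.adjoin K {X 1}) (hr : 0 < r)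
    (hfs : f - X 1 ^ r ∈ slices (X 1) r (fun _ => polyMod X 0 𝓗)) {m : ℕ} (hm : m < n) :
    𝓘 f (m + 1) ≤
    slices (X (m + 1)) r (fun _ => 𝓘 f m) ⊔ conjMod K n X T f m (m + 1) := by
  intro a ha
  refine map_mem_of_mem_polyMod LinearMap.id _ (fun s hs => ?_) (fun k a h1 hk _ h => ?_) ha
  · refine idealBase_le (fun i hi h hh => ?_) hs
    rcases Nat.lt_or_ge i m with him | him
    · refine Submodule.mem_sup_left ?_
      simpa using pow_mul_mem_slices (x := X (m + 1)) (N := fun _ => 𝓘 f m) hr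
        (base_mem_polyMod (conjSeq_mul_mem_idealBase him hh))
    · obtain rfl : i = m := by omega
      exact Submodule.mem_sup_right (base_mem_polyMod ⟨h, hh, rfl⟩)
  · obtain ⟨y, hy, z, hz, e⟩ := Submodule.mem_sup.1 h
    rw [LinearMap.id_apply] at e ⊢
    rw [← e, mul_add]
    refine Submodule.add_mem _ ?_ (Submodule.mem_sup_right (mul_mem_polyMod h1 hk hz))
    rcases Nat.lt_or_ge k (m + 1) with hkm | hkm
    · exact Submodule.mem_sup_left (mul_mem_slices_of_commute
        (hA.commute_X h1 (by omega) (by omega : 1 ≤ m + 1) (by omega))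
        (fun e _ a ha => mul_mem_polyMod h1 (by omega) ha) hy)
    · obtain rfl : k = m + 1 := by omega
      refine map_mem_slices (LinearMap.mulLeft K (X (m + 1))) (fun e he a ha => ?_) hy
      rw [LinearMap.mulLeft_apply, ← mul_assoc, ← pow_succ']
      rcases Nat.lt_or_ge (e + 1) r with her | her
      · exact Submodule.mem_sup_left (pow_mul_mem_slices her ha)
      · obtain rfl : r = e + 1 := by omega
        exact hA.pow_mul_ideal_mem hq hf hr hfs hm ha

omit hq hA

/-- `X (m + 1)` is free over the span of `X_1^{c_1} ⋯ X_m^{c_m} h`. -/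
def IsFreeX (K : Type*) {B : Type*} [Field K] [Ring B] [Algebra K B] (n : ℕ) (X T : ℕ → B) : Prop :=
  ∀ m < n, ∀ (L : ℕ) (a : ℕ → B), (∀ k, a k ∈ polyMod X m (heckeSpan K n T)) →
    ∑ k ∈ Finset.range L, X (m + 1) ^ k * a k = 0 → ∀ k < L, a k = 0

/-- The graph of the correspondence `∑ X^c h ↦ ∑ X^c F_m h`. -/
def conjGraph (K : Type*) {B : Type*} [Field K] [Ring B] [Algebra K B] (n : ℕ) (X T : ℕ → B)
    (f : B) (m m' : ℕ) : Submodule K (B × B) :=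
  polyMod (fun k => (X k, X k)) m'
    ((heckeSpan K n T).map (LinearMap.prod LinearMap.id (LinearMap.mulLeft K (conjSeq T f m))))

theorem fst_mem_of_mem_conjGraph {m m' : ℕ} {z : B × B} (hz : z ∈ conjGraph K n X T f m m') :
    z.1 ∈ polyMod X m' 𝓗 := by
  refine map_mem_of_mem_polyMod (LinearMap.fst K B B) _ ?_
    (fun k a h1 hk _ h => mul_mem_polyMod h1 hk h) hz
  rintro _ ⟨h, hh, rfl⟩
  exact base_mem_polyMod hh

theorem exists_mem_conjGraph {m m' : ℕ} {y : B} (hy : y ∈ conjMod K n X T f m m') :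
    ∃ a, (a, y) ∈ conjGraph K n X T f m m' := by
  suffices y ∈ (conjGraph K n X T f m m').map (LinearMap.snd K B B) by
    obtain ⟨⟨a, y'⟩, h, rfl⟩ := this
    exact ⟨a, h⟩
  refine map_mem_of_mem_polyMod LinearMap.id _ ?_ ?_ hy
  · rintro _ ⟨h, hh, rfl⟩
    exact ⟨(h, conjSeq T f m * h), base_mem_polyMod ⟨h, hh, rfl⟩, rfl⟩
  · rintro k _ h1 hk - ⟨z, hz, rfl⟩
    exact ⟨(X k, X k) * z, mul_mem_polyMod (X := fun k => (X k, X k)) h1 hk hz, rfl⟩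

include hA in
theorem eq_zero_of_mem_conjGraph (hFree : IsFreeX K n X T) {m m' : ℕ} (hm : m' ≤ n) {z : B × B}
    (hz : z ∈ conjGraph K n X T f m m') (h0 : z.1 = 0) : z.2 = 0 := by
  induction m' generalizing z with
  | zero =>
    rw [conjGraph, polyMod_zero] at hz
    obtain ⟨h, -, rfl⟩ := hz
    obtain rfl : h = 0 := h0
    simp
  | succ m' ih =>
    obtain ⟨L, b, hb, rfl⟩ := exists_mem_slices_of_mem_polyMod_succ
      (fun k h1 hk => by simp [hA.comm_X k (m' + 1) h1 (by omega) (by omega) hm]) hz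
    have h1 := hFree m' hm L (fun k => (b k).1) (fun k => fst_mem_of_mem_conjGraph (hb k))
      (by simpa [Prod.fst_sum] using h0)
    rw [Prod.snd_sum]
    refine Finset.sum_eq_zero fun k hk => ?_
    rw [Prod.snd_mul, ih (by omega) (hb k) (h1 k (Finset.mem_range.1 hk)), mul_zero]

include hA hq in
theorem sub_mem_slices_of_mem_conjGraph
    (hr : 0 < r)
    (hfs : f - X 1 ^ r ∈ slices (X 1) r (fun _ => polyMod X 0 𝓗)) {m : ℕ} (hm : m < n) {z : B × B}
    (hz : z ∈ conjGraph K n X T f m m) :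
    z.2 - q ^ m • (X (m + 1) ^ r * z.1) ∈ slices (X (m + 1)) r (fun _ => polyMod X m 𝓗) := by
  refine map_mem_of_mem_polyMod (LinearMap.snd K B B -
    q ^ m • (LinearMap.mulLeft K (X (m + 1) ^ r)).comp (LinearMap.fst K B B)) _ ?_ ?_ hz
  · rintro _ ⟨h, hh, rfl⟩
    have := mul_mem_slices_right (h := h) (N' := fun _ => polyMod X m 𝓗)
      (fun e _ a ha => polySpan_mul_right (fun s hs => mul_mem_heckeSpan hs hh) ha)
      (hA.conjSeq_sub_mem hq hr hfs hm)
    simpa [sub_mul] using this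
  · intro k a h1 hk _ h
    have hc := hA.commute_X h1 (by omega) (by omega : 1 ≤ m + 1) (by omega)
    have := mul_mem_slices_of_commute hc (N' := fun _ => polyMod X m 𝓗)
      (fun e _ a ha => mul_mem_polyMod h1 hk ha) h
    have e : X (m + 1) ^ r * (X k * a.1) = X k * (X (m + 1) ^ r * a.1) := by
      rw [← mul_assoc, ← (hc.pow_right r).eq, mul_assoc]
    simpa [mul_sub, e] using this

theorem IsFreeX.eq_zero (hFree : IsFreeX K n X T) {m : ℕ} (hm : m < n) {N : ℕ} {c : B}
    (hc : c ∈ polyMod X m 𝓗)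
    (h : X (m + 1) ^ N * c ∈ slices (X (m + 1)) N (fun _ => polyMod X m 𝓗)) : c = 0 := by
  obtain ⟨b, hb, e⟩ := h
  have := hFree m hm (N + 1) (fun k => if k = N then c else -b k)
    (fun k => by
      split_ifs
      · exact hc
      · exact Submodule.neg_mem _ (hb k))
    (by
      rw [Finset.sum_range_succ, if_pos rfl, e, ← Finset.sum_add_distrib]
      refine Finset.sum_eq_zero fun k hk => ?_
      rw [Finset.mem_range] at hk
      rw [if_neg hk.ne, mul_neg, neg_add_cancel]) N (by omega)
  simpa using this

include hA hq in
theorem eq_zero_of_sum_mem_slices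
    (hr : 0 < r)
    (hfs : f - X 1 ^ r ∈ slices (X 1) r (fun _ => polyMod X 0 𝓗)) (hFree : IsFreeX K n X T)
    {m : ℕ} (hm : m < n) (L : ℕ)
    (y : ℕ → B) (hy : ∀ k, y k ∈ conjMod K n X T f m m)
    (h : ∑ k ∈ Finset.range L, X (m + 1) ^ k * y k ∈
      slices (X (m + 1)) r (fun _ => polyMod X m 𝓗)) : ∀ k < L, y k = 0 := by
  choose a ha using fun k => exists_mem_conjGraph (hy k)
  have hsub := fun k => hA.sub_mem_slices_of_mem_conjGraph hq hr hfs hm (ha k)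
  have hshift : ∀ (j k M : ℕ), k + j ≤ M → ∀ z ∈ slices (X (m + 1)) j (fun _ => polyMod X m 𝓗),
      X (m + 1) ^ k * z ∈ slices (X (m + 1)) M (fun _ => polyMod X m 𝓗) := by
    intro j k M hM z hz
    refine map_mem_slices (LinearMap.mulLeft K (X (m + 1) ^ k)) (fun e he b hb => ?_) hz
    rw [LinearMap.mulLeft_apply, ← mul_assoc, ← pow_add]
    exact pow_mul_mem_slices (by omega) hb
  have hterm : ∀ k, X (m + 1) ^ k * y k = X (m + 1) ^ k * (y k - q ^ m • (X (m + 1) ^ r * a k)) +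
      q ^ m • (X (m + 1) ^ (k + r) * a k) := fun k => by
    rw [mul_sub, mul_smul_comm, pow_add, mul_assoc, sub_add_cancel]
  induction L with
  | zero => simp
  | succ L ih =>
    have hlow : ∑ k ∈ Finset.range L, X (m + 1) ^ k * y k ∈
        slices (X (m + 1)) (L + r) (fun _ => polyMod X m 𝓗) := by
      refine Submodule.sum_mem _ fun k hk => ?_
      rw [Finset.mem_range] at hk
      rw [hterm]
      exact Submodule.add_mem _ (hshift r k _ (by omega) _ (hsub k)) (Submodule.smul_mem _ _
        (pow_mul_mem_slices (by omega) (fst_mem_of_mem_conjGraph (ha k))))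
    have htop : X (m + 1) ^ (L + r) * a L ∈
        slices (X (m + 1)) (L + r) (fun _ => polyMod X m 𝓗) := by
      rw [Finset.sum_range_succ, hterm] at h
      have h' := Submodule.sub_mem _ (Submodule.sub_mem _ (slices_mono (r' := L + r) (by omega)
        (fun _ _ => le_rfl) h) hlow) (hshift r L _ le_rfl _ (hsub L))
      have := Submodule.smul_mem _ (q ^ m)⁻¹ h'
      rwa [add_sub_cancel_left, add_sub_cancel_left, smul_smul,
        inv_mul_cancel₀ (pow_ne_zero _ hq), one_smul] at this
    have ha0 : a L = 0 := hFree.eq_zero hm (fst_mem_of_mem_conjGraph (ha L)) htop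
    have hy0 : y L = 0 := hA.eq_zero_of_mem_conjGraph hFree hm.le (ha L) ha0
    rw [Finset.sum_range_succ, hy0, mul_zero, add_zero] at h
    intro k hk
    rcases Nat.lt_or_ge k L with hkL | hkL
    · exact ih h k hkL
    · obtain rfl : k = L := by omega
      exact hy0

include hA hq in
/-- No nonzero truncated element lies in the ideal generated by `f`. -/
theorem eq_zero_of_mem_truncSpan_of_mem_ideal
    (hf : f ∈ Algebra.adjoin K {X 1}) (hr : 0 < r)
    (hfs : f - X 1 ^ r ∈ slices (X 1) r (fun _ => polyMod X 0 𝓗)) (hFree : IsFreeX K n X T)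
    {m : ℕ} (hm : m ≤ n)
    {d : ZMod 1} {z : B} (hz : z ∈ truncSpan K n X T 1 r m d) (hz' : z ∈ 𝓘 f m) : z = 0 := by
  induction m generalizing d z with
  | zero =>
    rw [idealMod, polyMod_zero] at hz'
    exact idealBase_le (N := ⊥) (fun i hi => by omega) hz'
  | succ m ih =>
    obtain ⟨b, hb, e⟩ := hz
    obtain ⟨_, ⟨c, hc, rfl⟩, u, hu, e'⟩ :=
      Submodule.mem_sup.1 (hA.ideal_succ_le hq hf hr hfs hm hz')
    obtain ⟨L, y, hy, rfl⟩ := exists_mem_slices_of_mem_polyMod_succ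
      (fun k h1 hk => hA.comm_X k (m + 1) h1 (by omega) (by omega) hm) hu
    have hbc : ∀ k, b k - c k ∈ polyMod X m 𝓗 := fun k =>
      Submodule.sub_mem _ (truncSpan_le_polyMod r m _ (hb k)) (hA.ideal_le hq hf (by omega) (hc k))
    have hsum : ∑ k ∈ Finset.range L, X (m + 1) ^ k * y k =
        ∑ k ∈ Finset.range r, X (m + 1) ^ k * (b k - c k) := by
      simp only [mul_sub, Finset.sum_sub_distrib]
      rw [← e, ← e', add_sub_cancel_left]
    have hy0 := hA.eq_zero_of_sum_mem_slices hq hr hfs hFree hm L y hy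
      (by rw [hsum]; exact ⟨_, hbc, rfl⟩)
    have h0 := hFree m hm r _ hbc (by
      rw [← hsum]
      exact Finset.sum_eq_zero fun k hk => by rw [hy0 k (Finset.mem_range.1 hk), mul_zero])
    rw [e]
    refine Finset.sum_eq_zero fun k hk => ?_
    have hk' := Finset.mem_range.1 hk
    rw [ih (by omega) (hb k) (sub_eq_zero.1 (h0 k hk') ▸ hc k), mul_zero]

end

end IsAffineHecke

end Independence

section ReducedWords

/-- The word `l` only has the letters `1, …, n - 1`. -/
def IsWord (n : ℕ) (l : List ℕ) : Prop := ∀ i ∈ l, 1 ≤ i ∧ i < n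

theorem wordPerm_concat (n : ℕ) (l : List ℕ) (i : ℕ) :
    wordPerm n (l ++ [i]) = sswap n i * wordPerm n l := by
  simp [wordPerm]

theorem sswap_mul_sswap (n i : ℕ) : sswap n i * sswap n i = 1 := by
  unfold sswap
  split_ifs <;> simp

theorem sswap_inv (n i : ℕ) : (sswap n i)⁻¹ = sswap n i :=
  inv_eq_of_mul_eq_one_right (sswap_mul_sswap n i)

theorem wordPerm_inv (n : ℕ) (l : List ℕ) : (wordPerm n l)⁻¹ = (l.map (sswap n)).prod := by
  induction l using List.reverseRecOn with
  | nil => simp [wordPerm]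
  | append_singleton l i ih => rw [wordPerm_concat, mul_inv_rev, ih, sswap_inv]; simp

theorem exists_word_of_fixed {n : ℕ} (m : ℕ) (hm : m ≤ n) :
    ∀ w : Equiv.Perm ℕ, IsSnPerm m w → ∃ l, IsWord n l ∧ wordPerm n l = w := by
  induction m with
  | zero =>
    intro w hw
    refine ⟨[], by simp [IsWord], ?_⟩
    ext k
    rw [hw k (by omega)]
    simp [wordPerm]
  | succ m ih =>
    suffices H : ∀ d, ∀ w : Equiv.Perm ℕ, IsSnPerm (m + 1) w → m + 1 = w (m + 1) + d →
        ∃ l, IsWord n l ∧ wordPerm n l = w by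
      intro w hw
      by_cases h : w (m + 1) ≤ m + 1
      · exact H (m + 1 - w (m + 1)) w hw (by omega)
      · have := w.injective (hw (w (m + 1)) (by omega))
        omega
    intro d
    induction d with
    | zero =>
      intro w hw h
      refine ih (by omega) w fun k hk => ?_
      by_cases hkm : k = m + 1
      · subst hkm; omega
      · exact hw k (by omega)
    | succ d ihd =>
      intro w hw h
      have hk : w (m + 1) ≠ 0 := fun h0 => by
        have := w.injective (h0.trans (hw 0 (Or.inl rfl)).symm)
        omega
      have hs : sswap n (w (m + 1)) = Equiv.swap (w (m + 1)) (w (m + 1) + 1) :=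
        if_pos ⟨by omega, by omega⟩
      obtain ⟨l, hl, hlw⟩ := ihd (sswap n (w (m + 1)) * w) (fun k hk => by
        rw [Equiv.Perm.mul_apply, hw k hk, hs,
          Equiv.swap_apply_of_ne_of_ne (by omega) (by omega)]) (by
          rw [Equiv.Perm.mul_apply, hs, Equiv.swap_apply_left]; omega)
      refine ⟨l ++ [w (m + 1)], fun i hi => ?_, ?_⟩
      · rw [List.mem_append, List.mem_singleton] at hi
        rcases hi with hi | rfl
        · exact hl i hi
        · omega
      · rw [wordPerm_concat, hlw, ← mul_assoc, sswap_mul_sswap, one_mul]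

theorem exists_isReducedWordFor {n : ℕ} {w : Equiv.Perm ℕ} (hw : IsSnPerm n w) :
    ∃ l, IsReducedWordFor n w l := by
  have h : ∃ k, ∃ l, (IsWord n l ∧ wordPerm n l = w) ∧ l.length = k := by
    obtain ⟨l, hl⟩ := exists_word_of_fixed n le_rfl w hw
    exact ⟨_, l, hl, rfl⟩
  classical
  obtain ⟨l, hl, hlen⟩ := Nat.find_spec h
  exact ⟨l, hl.1, hl.2, fun l' hl' => hlen ▸ Nat.find_min' h ⟨l', hl', rfl⟩⟩

/-- The chosen reduced word of `w`. -/
def redWord (n : ℕ) (w : {w : Equiv.Perm ℕ // IsSnPerm n w}) : List ℕ :=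
  Classical.choose (exists_isReducedWordFor w.2)

theorem redWord_spec (n : ℕ) (w : {w : Equiv.Perm ℕ // IsSnPerm n w}) :
    IsReducedWordFor n w.1 (redWord n w) :=
  Classical.choose_spec (exists_isReducedWordFor w.2)

/-- The product of the `T i` along the chosen reduced word of `w`. -/
def TwIn {B : Type*} [Monoid B] (n : ℕ) (T : ℕ → B) (w : {w : Equiv.Perm ℕ // IsSnPerm n w}) : B :=
  ((redWord n w).map T).prod

theorem map_TwIn {B C : Type*} [Monoid B] [Monoid C] (φ : B →* C) (n : ℕ) (T : ℕ → B)
    (w : {w : Equiv.Perm ℕ // IsSnPerm n w}) : φ (TwIn n T w) = TwIn n (φ ∘ T) w := by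
  simp [TwIn, map_list_prod]

theorem Tw_eq_TwIn {K : Type} [CommRing K] (q : K) (p : ℕ) {t : ℕ} (Q : Fin t → K) (n : ℕ)
    (w : {w : Equiv.Perm ℕ // IsSnPerm n w}) : Tw K q p Q n w = TwIn n (Tg K q p Q n) w :=
  dif_pos (exists_isReducedWordFor w.2)

/-- `IsSnPerm n` cuts out a copy of the symmetric group of `{1, …, n}`. -/
def isSnPermEquiv (n : ℕ) :
    Equiv.Perm {k : ℕ // 1 ≤ k ∧ k ≤ n} ≃ {w : Equiv.Perm ℕ // IsSnPerm n w} :=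
  (Equiv.Perm.subtypeEquivSubtypePerm fun k : ℕ => 1 ≤ k ∧ k ≤ n).trans
    (Equiv.subtypeEquivRight fun w => forall_congr' fun k => by
      rw [show (k = 0 ∨ n < k) ↔ ¬(1 ≤ k ∧ k ≤ n) by omega])

instance fintypeIcc (n : ℕ) : Fintype {k : ℕ // 1 ≤ k ∧ k ≤ n} :=
  Fintype.subtype (Finset.Icc 1 n) (by simp)

instance fintypeIsSnPerm (n : ℕ) : Fintype {w : Equiv.Perm ℕ // IsSnPerm n w} :=
  Fintype.ofEquiv _ (isSnPermEquiv n)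

theorem card_isSnPerm (n : ℕ) : Fintype.card {w : Equiv.Perm ℕ // IsSnPerm n w} = n.factorial := by
  rw [← Fintype.card_congr (isSnPermEquiv n), Fintype.card_perm,
    Fintype.card_of_subtype (Finset.Icc 1 n) (by simp)]
  simp

end ReducedWords

section DimensionBound

open scoped Pointwise

variable {K B : Type*} [Field K] [Ring B] [Algebra K B] {n : ℕ} {q : K} {T : ℕ → B}

/-- The product `T_M T_{M-1} ⋯ T_{M-k+1}`. -/
def descProd (T : ℕ → B) (M : ℕ) : ℕ → B
  | 0 => 1
  | k + 1 => descProd T M k * T (M - k)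

theorem IsHecke.descProd_commute (hT : IsHecke n q T) {M : ℕ} (hM : M < n) (k : ℕ) :
    ∀ j, 1 ≤ j → j + k < M → Commute (descProd T M k) (T j) := by
  induction k with
  | zero => intro j _ _; exact Commute.one_left _
  | succ k ih =>
    intro j hj hjk
    exact (ih j hj (by omega)).mul_left
      (hT.commute (by omega) (by omega) hj (by omega) (by omega) (by omega))

theorem IsHecke.descProd_mul (hT : IsHecke n q T) {M : ℕ} (hM : M < n) (k : ℕ) :
    ∀ j, j ≤ M → k ≤ M → M + 1 < j + k → descProd T M k * T j = T (j - 1) * descProd T M k := by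
  induction k with
  | zero => intro j _ _ _; omega
  | succ k ih =>
    intro j hj hk hjk
    by_cases h : M + 1 < j + k
    · have hc := hT.commute (i := M - k) (j := j) (by omega) (by omega) (by omega) (by omega)
        (by omega) (by omega)
      rw [descProd, mul_assoc, hc.eq, ← mul_assoc, ih j hj (by omega) h, mul_assoc]
    · obtain ⟨k, rfl⟩ : ∃ k', k = k' + 1 := ⟨k - 1, by omega⟩
      obtain ⟨i, rfl⟩ : ∃ i, j = i + 1 := ⟨j - 1, by omega⟩
      have h1 : M - k = i + 1 := by omega
      have h2 : M - (k + 1) = i := by omega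
      have hb := hT.braid i (by omega) (by omega)
      have hc := (hT.descProd_commute hM k i (by omega) (by omega)).eq
      simp only [descProd, h1, h2, Nat.add_sub_cancel]
      calc descProd T M k * T (i + 1) * T i * T (i + 1)
          = descProd T M k * (T (i + 1) * T i * T (i + 1)) := by noncomm_ring
        _ = (descProd T M k * T i) * T (i + 1) * T i := by rw [← hb]; noncomm_ring
        _ = _ := by rw [hc]; noncomm_ring

theorem IsHecke.exists_spanning_finset (hT : IsHecke n q T) (m : ℕ) (hm : m < n) :
    ∃ s : Finset B, s.card ≤ (m + 1).factorial ∧ (1 : B) ∈ Submodule.span K (s : Set B) ∧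
      ∀ j, 1 ≤ j → j ≤ m → ∀ a ∈ Submodule.span K (s : Set B),
        a * T j ∈ Submodule.span K (s : Set B) := by
  classical
  induction m with
  | zero => exact ⟨{1}, by simp, Submodule.subset_span (by simp), fun j _ _ => by omega⟩
  | succ m ih =>
    obtain ⟨s, hs, h1, hmul⟩ := ih (by omega)
    set D : Finset B := (Finset.range (m + 2)).image (descProd T (m + 1)) with hD
    have hDk : ∀ k, k ≤ m + 1 → descProd T (m + 1) k ∈ Submodule.span K (D : Set B) :=
      fun k hk => Submodule.subset_span
        (Finset.mem_coe.2 (Finset.mem_image_of_mem _ (Finset.mem_range.2 (by omega))))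
    have hspan : Submodule.span K ((s * D : Finset B) : Set B) =
        Submodule.span K (s : Set B) * Submodule.span K (D : Set B) := by
      rw [Finset.coe_mul, Submodule.span_mul_span]
    refine ⟨s * D, ?_, ?_, ?_⟩
    · calc (s * D).card ≤ s.card * D.card := Finset.card_mul_le
        _ ≤ (m + 1).factorial * (m + 2) :=
          Nat.mul_le_mul hs (Finset.card_image_le.trans (by simp))
        _ = _ := by rw [Nat.factorial_succ (m + 1), mul_comm]
    · rw [hspan, ← mul_one (1 : B)]
      exact Submodule.mul_mem_mul h1 (hDk 0 (by omega))
    · intro j hj hjm a ha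
      rw [hspan] at ha ⊢
      induction ha using Submodule.mul_induction_on' with
      | add x _ y _ hx hy => rw [add_mul]; exact add_mem hx hy
      | mem_mul_mem u hu v hv =>
        induction hv using Submodule.span_induction with
        | zero => simp
        | add x y _ _ hx hy => rw [mul_add, add_mul]; exact add_mem hx hy
        | smul c x _ hx => rw [mul_smul_comm, smul_mul_assoc]; exact Submodule.smul_mem _ _ hx
        | mem x hx =>
          obtain ⟨k, hk, rfl⟩ := Finset.mem_image.1 (Finset.mem_coe.1 hx)
          have hk' : k ≤ m + 1 := by have := Finset.mem_range.1 hk; omega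
          rcases lt_trichotomy (j + k) (m + 1) with h | h | h
          · rw [mul_assoc, (hT.descProd_commute hm k j hj h).eq, ← mul_assoc]
            exact Submodule.mul_mem_mul (hmul j hj (by omega) u hu) (hDk k hk')
          · rw [show j = m + 1 - k by omega, mul_assoc]
            exact Submodule.mul_mem_mul hu (hDk (k + 1) (by omega))
          · by_cases h' : m + 1 + 1 < j + k
            · rw [mul_assoc, hT.descProd_mul hm k j hjm hk' h', ← mul_assoc]
              exact Submodule.mul_mem_mul (hmul (j - 1) (by omega) (by omega) u hu) (hDk k hk')
            · obtain ⟨k, rfl⟩ : ∃ k', k = k' + 1 := ⟨k - 1, by omega⟩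
              have : descProd T (m + 1) (k + 1) * T j =
                  (q - 1) • descProd T (m + 1) (k + 1) + q • descProd T (m + 1) k := by
                rw [descProd, show m + 1 - k = j by omega, mul_assoc, hT.quad j hj (by omega)]
                simp [mul_add]
              rw [mul_assoc, this]
              exact Submodule.mul_mem_mul hu (add_mem (Submodule.smul_mem _ _ (hDk _ hk'))
                (Submodule.smul_mem _ _ (hDk k (by omega))))

theorem IsHecke.exists_heckeSpan_le (hT : IsHecke n q T) (hn : 0 < n) :
    ∃ s : Finset B, s.card ≤ n.factorial ∧ heckeSpan K n T ≤ Submodule.span K (s : Set B) := by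
  obtain ⟨s, hs, h1, hmul⟩ := hT.exists_spanning_finset (n - 1) (by omega)
  refine ⟨s, by rwa [Nat.sub_add_cancel hn] at hs, fun a ha => ?_⟩
  suffices H : ∀ u ∈ Submodule.span K (s : Set B), u * a ∈ Submodule.span K (s : Set B) by
    simpa using H 1 h1
  have ha' : a ∈ Algebra.adjoin K {x | ∃ i, 1 ≤ i ∧ i < n ∧ x = T i} := ha
  induction ha' using Algebra.adjoin_induction with
  | mem x hx =>
    obtain ⟨i, hi, hin, rfl⟩ := hx
    exact hmul i hi (by omega)
  | algebraMap c =>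
    intro u hu
    rw [← Algebra.commutes, ← Algebra.smul_def]
    exact Submodule.smul_mem _ _ hu
  | add x y hx hy h1 h2 => intro u hu; rw [mul_add]; exact add_mem (h1 hx u hu) (h2 hy u hu)
  | mul x y hx hy h1 h2 => intro u hu; rw [← mul_assoc]; exact h2 hy _ (h1 hx u hu)

theorem TwIn_mem_heckeSpan (w : {w : Equiv.Perm ℕ // IsSnPerm n w}) :
    TwIn n T w ∈ heckeSpan K n T :=
  Subalgebra.list_prod_mem _ fun x hx => by
    obtain ⟨i, hi, rfl⟩ := List.mem_map.1 hx
    exact T_mem_heckeSpan ((redWord_spec n w).1 i hi).1 ((redWord_spec n w).1 i hi).2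

/-- If the `T_w` are linearly independent then they span the finite Hecke algebra. -/
theorem IsHecke.heckeSpan_eq (hT : IsHecke n q T) (hn : 0 < n)
    (hli : LinearIndependent K (TwIn n T)) :
    heckeSpan K n T = Submodule.span K (Set.range (TwIn n T)) := by
  obtain ⟨s, hs, hle⟩ := hT.exists_heckeSpan_le hn
  have hsub : Submodule.span K (Set.range (TwIn n T)) ≤ heckeSpan K n T :=
    Submodule.span_le.2 (by rintro _ ⟨w, rfl⟩; exact TwIn_mem_heckeSpan w)
  have : Module.Finite K (Submodule.span K (s : Set B)) :=
    Module.Finite.span_of_finite K s.finite_toSet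
  refine ((Submodule.eq_of_le_of_finrank_le (hsub.trans hle) ?_).symm ▸ hle).antisymm hsub
  rw [finrank_span_eq_card hli, card_isSnPerm]
  exact (finrank_span_finset_le_card s).trans hs

end DimensionBound

section Triangular

variable {ι F V : Type*} [Field F] [AddCommGroup V] [Module F V]

/-- A unitriangular-up-to-scalars family with respect to a linearly independent family is
linearly independent. -/
theorem linearIndependent_of_triangular {v t : ι → V} (hv : LinearIndependent F v) (ℓ : ι → ℕ)
    (a : ι → F) (ha : ∀ w, a w ≠ 0)
    (h : ∀ w, t w - a w • v w ∈ Submodule.span F (v '' {u | ℓ u < ℓ w})) :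
    LinearIndependent F t := by
  classical
  rw [linearIndependent_iff']
  intro s g hg
  by_contra! hne
  obtain ⟨w, hw, hmax⟩ := (s.filter fun w => g w ≠ 0).exists_max_image ℓ (by
    obtain ⟨i, hi, hgi⟩ := hne
    exact ⟨i, Finset.mem_filter.2 ⟨hi, hgi⟩⟩)
  obtain ⟨hws, hgw⟩ := Finset.mem_filter.1 hw
  refine hv.notMem_span_image (s := {u | u ≠ w}) (x := w) (by simp) ?_
  have hlow : ∀ u, ℓ u ≤ ℓ w →
      t u - a u • v u ∈ Submodule.span F (v '' {u | u ≠ w}) := fun u hu =>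
    Submodule.span_mono (Set.image_mono fun u' (hu' : ℓ u' < ℓ u) => by
      rintro rfl; omega) (h u)
  have hrest : ∑ u ∈ s.erase w, g u • t u ∈ Submodule.span F (v '' {u | u ≠ w}) := by
    refine Submodule.sum_mem _ fun u hu => ?_
    by_cases hgu : g u = 0
    · simp [hgu]
    obtain ⟨huw, hus⟩ := Finset.mem_erase.1 hu
    refine Submodule.smul_mem _ _ ?_
    rw [← sub_add_cancel (t u) (a u • v u)]
    exact add_mem (hlow u (hmax u (Finset.mem_filter.2 ⟨hus, hgu⟩)))
      (Submodule.smul_mem _ _ (Submodule.subset_span ⟨u, huw, rfl⟩))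
  have htw : t w ∈ Submodule.span F (v '' {u | u ≠ w}) := by
    rw [← Finset.add_sum_erase s _ hws] at hg
    rw [← Submodule.smul_mem_iff _ hgw, eq_neg_of_add_eq_zero_left hg]
    exact neg_mem hrest
  rw [← Submodule.smul_mem_iff _ (ha w)]
  simpa using sub_mem htw (hlow w le_rfl)

end Triangular

section PolynomialRepresentation

variable {K F : Type*} [Field K] [Field F] [Algebra K F] (q : K) (x : ℕ → F)
  (act : Equiv.Perm ℕ →* (F ≃ₐ[K] F))

/-- Multiplication by `x i`. -/
def polX (i : ℕ) : Module.End K F := x i • 1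

/-- The diagonal coefficient of a Demazure–Lusztig operator. -/
def dlDiag (i : ℕ) : F := algebraMap K F (q - 1) * x (i + 1) / (x (i + 1) - x i)

/-- The coefficient of the transposition in a Demazure–Lusztig operator. -/
def dlOff (i : ℕ) : F := (x (i + 1) - algebraMap K F q * x i) / (x (i + 1) - x i)

/-- The Demazure–Lusztig operators. -/
def polT (i : ℕ) : Module.End K F :=
  dlDiag q x i • 1 + dlOff q x i • (act (Equiv.swap i (i + 1))).toLinearMap

theorem polX_apply (i : ℕ) (g : F) : polX (K := K) x i g = x i * g := by simp [polX]

theorem polT_apply (i : ℕ) (g : F) :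
    polT q x act i g = dlDiag q x i * g + dlOff q x i * act (Equiv.swap i (i + 1)) g := by
  simp [polT]

variable {q x act}

theorem polT_isAffineHecke (n : ℕ) (hx : Function.Injective x)
    (hact : ∀ w i, act w (x i) = x (w i)) : IsAffineHecke n q (polX x) (polT q x act) := by
  have hd : ∀ {i j : ℕ}, i ≠ j → x i - x j ≠ 0 := fun h => sub_ne_zero.2 fun e => h (hx e)
  have hsq : ∀ i (g : F), act (Equiv.swap i (i + 1)) (act (Equiv.swap i (i + 1)) g) = g :=
    fun i g => by
      rw [← AlgEquiv.mul_apply, ← map_mul, Equiv.swap_mul_self, map_one, AlgEquiv.one_apply]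
  have hl : ∀ i, act (Equiv.swap i (i + 1)) (x i) = x (i + 1) := fun i => by
    rw [hact, Equiv.swap_apply_left]
  have hr : ∀ i, act (Equiv.swap i (i + 1)) (x (i + 1)) = x i := fun i => by
    rw [hact, Equiv.swap_apply_right]
  have hne : ∀ i k, k ≠ i → k ≠ i + 1 → act (Equiv.swap i (i + 1)) (x k) = x k :=
    fun i k h1 h2 => by rw [hact, Equiv.swap_apply_of_ne_of_ne h1 h2]
  refine { quad := ?_, braid := ?_, comm := ?_, T_X_T := ?_, comm_X := ?_, comm_T := ?_ }
  · intro i _ _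
    ext g
    have h1 := hd (show i + 1 ≠ i by omega)
    have h2 := hd (show i ≠ i + 1 by omega)
    simp only [Module.End.mul_apply, LinearMap.add_apply, LinearMap.smul_apply,
      Module.End.one_apply, polT_apply, dlDiag, dlOff, map_add, map_sub, map_mul, map_div₀,
      AlgEquiv.commutes, hl, hr, hsq, map_one]
    simp only [Algebra.smul_def (A := F), map_sub, map_one]
    field_simp
    ring
  · intro i _ _
    ext g
    have h1 := hd (show i + 1 ≠ i by omega)
    have h2 := hd (show i ≠ i + 1 by omega)
    have h3 := hd (show i + 2 ≠ i + 1 by omega)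
    have h4 := hd (show i + 1 ≠ i + 2 by omega)
    have h5 := hd (show i + 2 ≠ i by omega)
    have h6 := hd (show i ≠ i + 2 by omega)
    have hb : act (Equiv.swap i (i + 1)) (act (Equiv.swap (i + 1) (i + 2))
        (act (Equiv.swap i (i + 1)) g)) = act (Equiv.swap (i + 1) (i + 2))
        (act (Equiv.swap i (i + 1)) (act (Equiv.swap (i + 1) (i + 2)) g)) := by
      have h7 := Equiv.swap_mul_swap_mul_swap (show i + 2 ≠ i + 1 by omega)
          (show i + 2 ≠ i by omega)
      have h8 := Equiv.swap_mul_swap_mul_swap (show i ≠ i + 1 by omega) (show i ≠ i + 2 by omega)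
      rw [Equiv.swap_comm (i + 1) i, Equiv.swap_comm (i + 2) (i + 1), Equiv.swap_comm i (i + 2),
        ← h8] at h7
      simp only [← AlgEquiv.mul_apply, ← map_mul, ← mul_assoc, h7]
    have e1 := hne i (i + 2) (by omega) (by omega)
    have e2 := hne (i + 1) i (by omega) (by omega)
    simp only [Nat.add_assoc, Nat.reduceAdd] at e2
    simp only [Module.End.mul_apply, polT_apply, dlDiag, dlOff, map_add, map_sub, map_mul,
      map_div₀, AlgEquiv.commutes, Nat.add_assoc, Nat.reduceAdd, hl, hr, hsq, e1, e2,
      hb, map_one]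
    field_simp
    ring
  · intro i j _ hij _
    ext g
    have hb : act (Equiv.swap i (i + 1)) (act (Equiv.swap j (j + 1)) g) =
        act (Equiv.swap j (j + 1)) (act (Equiv.swap i (i + 1)) g) := by
      simp only [← AlgEquiv.mul_apply, ← map_mul]
      rw [(Equiv.Perm.disjoint_swap_swap (by
        simp; omega)).commute.eq]
    simp only [Module.End.mul_apply, polT_apply, dlDiag, dlOff, map_add, map_sub, map_mul,
      map_div₀, AlgEquiv.commutes, hb, hne i j (by omega) (by omega),
      hne i (j + 1) (by omega) (by omega), hne j i (by omega) (by omega),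
      hne j (i + 1) (by omega) (by omega)]
    ring
  · intro i _ _
    ext g
    have h1 := hd (show i + 1 ≠ i by omega)
    have h2 := hd (show i ≠ i + 1 by omega)
    simp only [Module.End.mul_apply, LinearMap.smul_apply, polT_apply, polX_apply, dlDiag, dlOff,
      map_add, map_sub, map_mul, map_div₀, AlgEquiv.commutes, hl, hr, hsq, map_one]
    simp only [Algebra.smul_def (A := F)]
    field_simp
    ring
  · intro i j _ _ _ _
    ext g
    simp only [Module.End.mul_apply, polX_apply]
    ring
  · intro i k _ _ _ _ h1 h2
    ext g
    simp only [Module.End.mul_apply, polT_apply, polX_apply, map_mul, hne i k h1 h2]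
    ring

/-- The `F`-span of the operators attached to words of length less than `k`. -/
def actSpan (act : Equiv.Perm ℕ →* (F ≃ₐ[K] F)) (n k : ℕ) : Submodule F (Module.End K F) :=
  Submodule.span F {y | ∃ l, IsWord n l ∧ l.length < k ∧
    y = (act (l.map (sswap n)).prod).toLinearMap}

theorem act_mul_mem_actSpan {n k i : ℕ} (hi : 1 ≤ i) (hin : i < n) {u : Module.End K F}
    (hu : u ∈ actSpan act n k) :
    (act (sswap n i)).toLinearMap * u ∈ actSpan act n (k + 1) := by
  induction hu using Submodule.span_induction with
  | mem y hy =>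
    obtain ⟨l, hl, hlk, rfl⟩ := hy
    refine Submodule.subset_span ⟨i :: l, ?_, by simpa using hlk, ?_⟩
    · rintro j (_ | ⟨_, hj⟩)
      exacts [⟨hi, hin⟩, hl j hj]
    · ext y; simp
  | zero => simp
  | add y z _ _ hy hz => rw [mul_add]; exact add_mem hy hz
  | smul g y _ hy =>
    have : (act (sswap n i)).toLinearMap * (g • y) =
        act (sswap n i) g • ((act (sswap n i)).toLinearMap * y) := by
      ext z; simp
    rw [this]
    exact Submodule.smul_mem _ _ hy

theorem exists_polT_prod_sub_mem (hx : Function.Injective x)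
    (hxq : ∀ i, x (i + 1) ≠ algebraMap K F q * x i) {n : ℕ} (l : List ℕ) (hl : IsWord n l) :
    ∃ a : F, a ≠ 0 ∧ (l.map (polT q x act)).prod - a • (act (l.map (sswap n)).prod).toLinearMap ∈
      actSpan act n l.length := by
  induction l with
  | nil => exact ⟨1, one_ne_zero, by
      rw [show (([] : List ℕ).map (polT q x act)).prod -
        (1 : F) • (act (([] : List ℕ).map (sswap n)).prod).toLinearMap = 0 by ext y; simp]
      exact zero_mem _⟩
  | cons i l ih =>
    obtain ⟨a, ha, hmem⟩ := ih fun j hj => hl j (List.mem_cons_of_mem _ hj)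
    obtain ⟨hi, hin⟩ := hl i List.mem_cons_self
    set P := (l.map (sswap n)).prod with hP
    set u := (l.map (polT q x act)).prod - a • (act P).toLinearMap with hu
    have hs : sswap n i = Equiv.swap i (i + 1) := if_pos ⟨hi, hin⟩
    refine ⟨dlOff q x i * act (sswap n i) a, mul_ne_zero (div_ne_zero (sub_ne_zero.2 (hxq i))
      (sub_ne_zero.2 fun e => by simpa using hx e)) (by simpa using ha), ?_⟩
    have key : ((i :: l).map (polT q x act)).prod -
        (dlOff q x i * act (sswap n i) a) •
          (act ((i :: l).map (sswap n)).prod).toLinearMap =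
        (dlDiag q x i * a) • (act P).toLinearMap + dlDiag q x i • u +
          dlOff q x i • ((act (sswap n i)).toLinearMap * u) := by
      have : (l.map (polT q x act)).prod = u + a • (act P).toLinearMap := by rw [hu]; abel
      rw [List.map_cons, List.prod_cons, List.map_cons, List.prod_cons, this, ← hP]
      ext y
      simp only [polT_apply, Module.End.mul_apply, LinearMap.add_apply, LinearMap.sub_apply,
        LinearMap.smul_apply, AlgEquiv.toLinearMap_apply, map_add, map_mul, smul_eq_mul, hs,
        AlgEquiv.mul_apply]
      ring
    have hmono : actSpan act n l.length ≤ actSpan act n (l.length + 1) :=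
      Submodule.span_mono fun y ⟨l', h1, h2, h3⟩ => ⟨l', h1, by omega, h3⟩
    rw [key, List.length_cons]
    refine add_mem (add_mem (Submodule.smul_mem _ _ (Submodule.subset_span
      ⟨l, fun j hj => hl j (List.mem_cons_of_mem _ hj), by omega, rfl⟩))
      (Submodule.smul_mem _ _ (hmono hmem)))
      (Submodule.smul_mem _ _ (act_mul_mem_actSpan hi hin hmem))

theorem linearIndependent_act (hx : Function.Injective x)
    (hact : ∀ w i, act w (x i) = x (w i)) (n : ℕ) :
    LinearIndependent F fun w : {w : Equiv.Perm ℕ // IsSnPerm n w} =>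
      ((act w.1⁻¹).toLinearMap : Module.End K F) := by
  refine LinearIndependent.of_comp (LinearMap.ltoFun K F F F) ?_
  refine (linearIndependent_monoidHom F F).comp (fun w : {w : Equiv.Perm ℕ // IsSnPerm n w} =>
    ((act w.1⁻¹ : F →ₐ[K] F) : F →* F)) fun w w' h => ?_
  refine Subtype.ext (inv_injective (Equiv.ext fun i => hx ?_))
  rw [← hact, ← hact]
  exact DFunLike.congr_fun h (x i)

theorem linearIndependent_TwIn_polT (hx : Function.Injective x)
    (hxq : ∀ i, x (i + 1) ≠ algebraMap K F q * x i) (hact : ∀ w i, act w (x i) = x (w i)) (n : ℕ) :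
    LinearIndependent F (TwIn n (polT q x act)) := by
  choose a ha hmem using fun w => exists_polT_prod_sub_mem (act := act) hx hxq (redWord n w)
    (redWord_spec n w).1
  refine linearIndependent_of_triangular (linearIndependent_act hx hact n)
    (fun w => (redWord n w).length) a ha fun w => ?_
  have h := hmem w
  rw [← wordPerm_inv, (redWord_spec n w).2.1] at h
  refine Submodule.span_mono ?_ h
  rintro y ⟨l, hl, hlen, rfl⟩
  have hSn : IsSnPerm n (wordPerm n l) := by
    intro k hk
    clear hlen
    induction l using List.reverseRecOn with
    | nil => simp [wordPerm]
    | append_singleton l i ih =>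
      obtain ⟨h1, h2⟩ := hl i (by simp)
      rw [wordPerm_concat, Equiv.Perm.mul_apply, ih fun j hj => hl j (by simp [hj]), sswap,
        if_pos ⟨h1, h2⟩, Equiv.swap_apply_of_ne_of_ne (by omega) (by omega)]
  refine ⟨⟨_, hSn⟩, lt_of_le_of_lt ((redWord_spec n ⟨_, hSn⟩).2.2 l ⟨hl, rfl⟩) hlen, ?_⟩
  rw [← wordPerm_inv]

end PolynomialRepresentation

section Freeness

variable {K F : Type*} [Field K] [Field F] [Algebra K F] {q : K} {x : ℕ → F}
  {act : Equiv.Perm ℕ →* (F ≃ₐ[K] F)}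

theorem ne_algebraMap_mul_of_algebraicIndependent (hx : AlgebraicIndependent K x) (i : ℕ) :
    x (i + 1) ≠ algebraMap K F q * x i := by
  intro h
  have := hx.linearIndependent.notMem_span_image (s := {i}) (x := i + 1) (by simp)
  refine this ?_
  rw [h, ← Algebra.smul_def]
  exact Submodule.smul_mem _ _ (Submodule.subset_span ⟨i, rfl, rfl⟩)

theorem linearIndependent_TwIn_polT' (hx : AlgebraicIndependent K x)
    (hact : ∀ w i, act w (x i) = x (w i)) (n : ℕ) :
    LinearIndependent K (TwIn n (polT q x act)) :=
  (linearIndependent_TwIn_polT hx.injective (ne_algebraMap_mul_of_algebraicIndependent hx) hact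
    n).restrict_scalars fun a b h => (algebraMap K F).injective (by
      simpa [Algebra.smul_def] using h)

theorem polyMod_le_span_adjoin {n : ℕ} (hn : 0 < n) (hx : AlgebraicIndependent K x)
    (hact : ∀ w i, act w (x i) = x (w i)) (m : ℕ) :
    polyMod (polX x) m (heckeSpan K n (polT q x act)) ≤
      (Submodule.span (Algebra.adjoin K (x '' {i | 1 ≤ i ∧ i ≤ m}))
        (Set.range (TwIn n (polT q x act)))).restrictScalars K := by
  intro a ha
  refine map_mem_of_mem_polyMod LinearMap.id _ (fun s hs => ?_) (fun k a h1 hk _ h => ?_) ha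
  · rw [(polT_isAffineHecke n hx.injective hact).toIsHecke.heckeSpan_eq hn
      (linearIndependent_TwIn_polT' hx hact n)] at hs
    exact Submodule.span_le_restrictScalars K _ _ hs
  · have : polX x k * a =
        (⟨x k, Algebra.subset_adjoin ⟨k, ⟨h1, hk⟩, rfl⟩⟩ :
          Algebra.adjoin K (x '' {i | 1 ≤ i ∧ i ≤ m})) • a := by
      ext g; simp [polX_apply, Subalgebra.smul_def]
    rw [LinearMap.id_apply, this]
    exact Submodule.smul_mem (Submodule.span _ _) _ h

theorem polX_pow (i e : ℕ) : (polX x i : Module.End K F) ^ e = x i ^ e • 1 := by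
  induction e with
  | zero => ext g; simp
  | succ e ih => ext g; rw [pow_succ, ih]; simp [polX_apply, pow_succ, mul_assoc]

theorem polX_isFreeX {n : ℕ} (hn : 0 < n) (hx : AlgebraicIndependent K x)
    (hact : ∀ w i, act w (x i) = x (w i)) :
    IsAffineHecke.IsFreeX K n (polX x) (polT q x act) := by
  intro m hm L a ha hsum
  set A := Algebra.adjoin K (x '' {i | 1 ≤ i ∧ i ≤ m}) with hA
  have hex : ∀ k, ∃ g : {w : Equiv.Perm ℕ // IsSnPerm n w} → A,
      ∑ w, g w • TwIn n (polT q x act) w = a k := fun k =>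
    (Submodule.mem_span_range_iff_exists_fun A).1 (polyMod_le_span_adjoin hn hx hact m (ha k))
  choose g hg using hex
  have hli := linearIndependent_TwIn_polT (q := q) hx.injective
    (ne_algebraMap_mul_of_algebraicIndependent hx) hact n
  have hzero : ∀ w, ∑ k ∈ Finset.range L, x (m + 1) ^ k * (g k w : F) = 0 := by
    refine Fintype.linearIndependent_iff.1 hli _ ?_
    rw [← hsum]
    simp only [Finset.sum_smul]
    rw [Finset.sum_comm]
    refine Finset.sum_congr rfl fun k _ => ?_
    rw [← hg k, Finset.mul_sum]
    refine Finset.sum_congr rfl fun w _ => ?_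
    rw [mul_smul, polX_pow, smul_one_mul]
    rfl
  have htr := transcendental_iff.1 (hx.transcendental_adjoin
    (s := {i | 1 ≤ i ∧ i ≤ m}) (i := m + 1) (by simp))
  intro k hk
  rw [← hg k]
  refine Finset.sum_eq_zero fun w _ => ?_
  have h0 := htr (∑ k ∈ Finset.range L, Polynomial.monomial k (g k w)) (by
    rw [map_sum, ← hzero w]
    refine Finset.sum_congr rfl fun k _ => ?_
    rw [Polynomial.aeval_monomial, mul_comm]
    rfl)
  have h1 : g k w = 0 := by
    simpa [Polynomial.finsetSum_coeff, Polynomial.coeff_monomial, hk] using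
      congrArg (Polynomial.coeff · k) h0
  rw [h1, zero_smul]

/-- The monomial `x_1^{c_1} ⋯ x_n^{c_n}`. -/
def monoIn {B : Type*} [Monoid B] (n : ℕ) (X : ℕ → B) (c : ℕ → ℕ) : B :=
  ((List.range n).map fun i => X (i + 1) ^ c (i + 1)).prod

theorem monoIn_succ {B : Type*} [Monoid B] (n : ℕ) (X : ℕ → B) (c : ℕ → ℕ) :
    monoIn (n + 1) X c = monoIn n X c * X (n + 1) ^ c (n + 1) := by
  simp [monoIn, List.range_succ]

theorem monoIn_polX (n : ℕ) (c : ℕ → ℕ) :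
    monoIn n (polX x : ℕ → Module.End K F) c = monoIn n x c • 1 := by
  induction n with
  | zero => ext g; simp [monoIn]
  | succ n ih => ext g; rw [monoIn_succ, monoIn_succ, ih, polX_pow]; simp [mul_assoc]

theorem monoIn_eq_prod {B : Type*} [CommMonoid B] (n : ℕ) (X : ℕ → B) (c : ℕ → ℕ) :
    monoIn n X c = ∏ i ∈ Finset.Icc 1 n, X i ^ c i := by
  induction n with
  | zero => simp [monoIn]
  | succ n ih => rw [monoIn_succ, ih, Finset.prod_Icc_succ_top (by omega)]

theorem linearIndependent_monoIn (hx : AlgebraicIndependent K x) (n : ℕ) :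
    LinearIndependent K fun c : {c : ℕ → ℕ // ∀ i, ¬(1 ≤ i ∧ i ≤ n) → c i = 0} =>
      monoIn n x c.1 := by
  have h1 : LinearIndependent K fun s : ℕ →₀ ℕ =>
      MvPolynomial.aeval x (MvPolynomial.basisMonomials ℕ K s) :=
    (MvPolynomial.basisMonomials ℕ K).linearIndependent.map' (MvPolynomial.aeval x).toLinearMap
      (LinearMap.ker_eq_bot.2 hx)
  have h2 := h1.comp (fun c : {c : ℕ → ℕ // ∀ i, ¬(1 ≤ i ∧ i ≤ n) → c i = 0} =>
    Finsupp.onFinset (Finset.Icc 1 n) c.1 fun i hi => by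
      by_contra h
      exact hi (c.2 i (by simpa using h))) fun c c' h => Subtype.ext (by
        simpa using congrArg (fun s : ℕ →₀ ℕ => (s : ℕ → ℕ)) h)
  convert h2 using 2 with c
  simp [monoIn_eq_prod, MvPolynomial.aeval_monomial]

theorem linearIndependent_monoIn_mul_TwIn (hx : AlgebraicIndependent K x)
    (hact : ∀ w i, act w (x i) = x (w i)) (n : ℕ) :
    LinearIndependent K
      fun cw : {c : ℕ → ℕ // ∀ i, ¬(1 ≤ i ∧ i ≤ n) → c i = 0} × {w // IsSnPerm n w} =>
        monoIn n (polX x) cw.1.1 * TwIn n (polT q x act) cw.2 := by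
  have h := linearIndependent_smul (linearIndependent_monoIn hx n)
    (linearIndependent_TwIn_polT (q := q) hx.injective
      (ne_algebraMap_mul_of_algebraicIndependent hx) hact n)
  simpa only [monoIn_polX, smul_one_mul] using h

end Freeness

section Existence

variable (K : Type*) [Field K]

/-- The action of permutations of `ℕ` on the field of rational functions. -/
def ratAct : Equiv.Perm ℕ →* (FractionRing (MvPolynomial ℕ K) ≃ₐ[K]
    FractionRing (MvPolynomial ℕ K)) :=
  (IsFractionRing.fieldEquivOfAlgEquivHom K (FractionRing (MvPolynomial ℕ K))).comp
    { toFun := fun w => MvPolynomial.renameEquiv K w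
      map_one' := by ext; simp
      map_mul' := fun w w' => by ext; simp }

/-- The variables of the field of rational functions. -/
def ratVar (i : ℕ) : FractionRing (MvPolynomial ℕ K) :=
  algebraMap (MvPolynomial ℕ K) _ (MvPolynomial.X i)

theorem ratAct_ratVar (w : Equiv.Perm ℕ) (i : ℕ) : ratAct K w (ratVar K i) = ratVar K (w i) := by
  simp [ratAct, ratVar]

theorem algebraicIndependent_ratVar : AlgebraicIndependent K (ratVar K) := by
  have h := (MvPolynomial.algebraicIndependent_X ℕ K).map'
    (f := IsScalarTower.toAlgHom K (MvPolynomial ℕ K) (FractionRing (MvPolynomial ℕ K)))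
    (IsFractionRing.injective _ _)
  exact h

/-- There is an algebra in which the affine Hecke relations hold and the standard monomials are
linearly independent. -/
theorem exists_affineHecke_model {K : Type*} [Field K] (q : K) {n : ℕ} (hn : 0 < n) :
    ∃ X T : ℕ → Module.End K (FractionRing (MvPolynomial ℕ K)),
      IsAffineHecke n q X T ∧ IsAffineHecke.IsFreeX K n X T ∧
      LinearIndependent K
        fun cw : {c : ℕ → ℕ // ∀ i, ¬(1 ≤ i ∧ i ≤ n) → c i = 0} × {w // IsSnPerm n w} =>
          monoIn n X cw.1.1 * TwIn n T cw.2 :=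
  have hx := algebraicIndependent_ratVar K
  have hact := ratAct_ratVar K
  ⟨polX (ratVar K), polT q (ratVar K) (ratAct K), polT_isAffineHecke n hx.injective hact,
    polX_isFreeX hn hx hact, linearIndependent_monoIn_mul_TwIn hx hact n⟩

end Existence

section Cyclotomic

open Polynomial

variable {K : Type*} [Field K]

/-- The cyclotomic polynomial `∏ (Y - Q_k ^ p)`, in the variable `Y = T_0 ^ p`. -/
def cycloPoly (p : ℕ) {t : ℕ} (Q : Fin t → K) : K[X] := ∏ k, (X - C (Q k ^ p))

variable {p t : ℕ} (Q : Fin t → K)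

theorem cycloPoly_monic : (cycloPoly p Q).Monic :=
  monic_prod_of_monic _ _ fun _ _ => monic_X_sub_C _

theorem cycloPoly_natDegree : (cycloPoly p Q).natDegree = t := by
  rw [cycloPoly, natDegree_prod_of_monic _ _ fun _ _ => monic_X_sub_C _]
  simp only [natDegree_X_sub_C]
  simp

variable {B : Type*} [Ring B] [Algebra K B]

theorem aeval_cycloPoly (y : B) : aeval (y ^ p) (cycloPoly p Q) =
    ((List.finRange t).map fun k => y ^ p - algebraMap K B (Q k ^ p)).prod := by
  rw [cycloPoly, ← List.prod_ofFn, List.ofFn_eq_map, map_list_prod, List.map_map]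
  congr 1
  refine List.map_congr_left fun k _ => ?_
  simp

theorem aeval_cycloPoly_mem_adjoin (y : B) :
    aeval (y ^ p) (cycloPoly p Q) ∈ Algebra.adjoin K {y} := by
  rw [← aeval_X_pow (R := K), ← aeval_comp]
  exact aeval_mem_adjoin_singleton K y

theorem aeval_cycloPoly_sub_mem_slices (hp : 0 < p) {ℓ : ℕ} (hℓ : (p : ZMod ℓ) = 0) (n : ℕ)
    (Y T : ℕ → B) : aeval (Y 1 ^ p) (cycloPoly p Q) - Y 1 ^ (p * t) ∈
      slices (Y 1) (p * t) (fun e => polySpan ℓ Y 0 (heckeSpan K n T) (-e)) := by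
  have h := (cycloPoly_monic (p := p) Q).as_sum
  rw [cycloPoly_natDegree] at h
  rw [h, map_add, map_pow, aeval_X, ← pow_mul, add_sub_cancel_left, map_sum]
  refine Submodule.sum_mem _ fun j hj => ?_
  have hjt := Finset.mem_range.1 hj
  rw [map_mul, aeval_C, map_pow, aeval_X, ← pow_mul, Algebra.commutes]
  refine pow_mul_mem_slices (Nat.mul_lt_mul_of_pos_left hjt hp) ?_
  rw [show (-((p * j : ℕ) : ZMod ℓ)) = 0 by simp [hℓ]]
  exact base_mem_polySpan (Subalgebra.algebraMap_mem _ _)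

/-- If `y ^ p` is a root of the cyclotomic polynomial then `y` is invertible. -/
theorem exists_inverse_of_aeval_cycloPoly (hp : 0 < p) (hQ : ∀ k, Q k ≠ 0) {y : B}
    (hy : aeval (y ^ p) (cycloPoly p Q) = 0) :
    ∃ g : K[X], y * (y ^ (p - 1) * aeval (y ^ p) g) = 1 := by
  have h0 : (cycloPoly p Q).coeff 0 ≠ 0 := by
    rw [coeff_zero_eq_eval_zero, cycloPoly, eval_prod]
    exact Finset.prod_ne_zero_iff.2 fun k _ => by simp [hQ k]
  refine ⟨C (-((cycloPoly p Q).coeff 0)⁻¹) * (cycloPoly p Q).divX, ?_⟩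
  rw [← mul_assoc, mul_pow_sub_one hp.ne', map_mul, aeval_C, ← mul_assoc, ← Algebra.commutes,
    mul_assoc]
  nth_rw 1 [← aeval_X (R := K) (y ^ p)]
  rw [← map_mul, X_mul]
  have h := congrArg (aeval (y ^ p)) (divX_mul_X_add (cycloPoly p Q))
  rw [map_add, hy, aeval_C] at h
  rw [eq_neg_of_add_eq_zero_left h, ← map_neg, ← map_mul]
  simp [h0]

end Cyclotomic

section Presentation

variable {K : Type} [Field K] (q : K) (p : ℕ) {t : ℕ} (Q : Fin t → K) (n : ℕ)

/-- The quotient map from the free algebra to the Ariki–Koike algebra. -/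
def mkAK : FreeAlgebra K (Fin n) →ₐ[K] AK K q p Q n := RingQuot.mkAlgHom K (AKRel K q p Q n)

/-- The `i`-th generator of the free algebra, or `1` if there is no such generator. -/
def freeT (K : Type) [Field K] (n i : ℕ) : FreeAlgebra K (Fin n) :=
  if h : i < n then FreeAlgebra.ι K ⟨i, h⟩ else 1

/-- Lifts of the Murphy elements to the free algebra. -/
def freeL (q : K) (n : ℕ) : ℕ → FreeAlgebra K (Fin n)
  | 0 => 1
  | 1 => freeT K n 0
  | k + 2 => q⁻¹ • (freeT K n (k + 1) * freeL q n (k + 1) * freeT K n (k + 1))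

theorem freeT_of_lt {i : ℕ} (h : i < n) : freeT K n i = FreeAlgebra.ι K ⟨i, h⟩ := dif_pos h

theorem mkAK_freeT (i : ℕ) : mkAK q p Q n (freeT K n i) = Tg K q p Q n i := by
  by_cases h : i < n
  · have e : Tg K q p Q n i = mkAK q p Q n (FreeAlgebra.ι K ⟨i, h⟩) := dif_pos h
    rw [e, freeT, dif_pos h]
  · have e : Tg K q p Q n i = 1 := dif_neg h
    rw [e, freeT, dif_neg h, map_one]

theorem mkAK_freeL (i : ℕ) : mkAK q p Q n (freeL q n i) = Lm K q p Q n i := by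
  induction i using Nat.strong_induction_on with
  | _ i ih =>
    match i with
    | 0 => exact map_one _
    | 1 => exact mkAK_freeT q p Q n 0
    | k + 2 => rw [freeL, Lm, map_smul, map_mul, map_mul, ih (k + 1) (by omega), mkAK_freeT,
        Ring.inverse_eq_inv']

variable {q p Q n}

theorem mkAK_rel {a b : FreeAlgebra K (Fin n)} (h : AKRel K q p Q n a b) :
    mkAK q p Q n a = mkAK q p Q n b := RingQuot.mkAlgHom_rel K h

theorem aeval_Tg_zero (hn : 0 < n) :
    Polynomial.aeval (Tg K q p Q n 0 ^ p) (cycloPoly p Q) = 0 := by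
  have h := mkAK_rel (AKRel.cyclo (q := q) (p := p) (Q := Q) hn)
  rw [← freeT_of_lt, ← aeval_cycloPoly, map_zero, ← Polynomial.aeval_algHom_apply, map_pow,
    mkAK_freeT] at h
  exact h

theorem AK_isHecke : IsHecke n q (Tg K q p Q n) where
  quad i hi hin := by
    have h := mkAK_rel (AKRel.quad (q := q) (p := p) (Q := Q) i hi hin)
    rw [← freeT_of_lt, map_mul, map_add, map_sub, map_one, map_zero, mkAK_freeT,
      AlgHom.commutes, add_mul, mul_sub, one_mul, ← Algebra.commutes, ← Algebra.smul_def,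
      Algebra.algebraMap_eq_smul_one] at h
    rw [← sub_eq_zero, ← h]
    module
  braid i hi hin := by
    have h := mkAK_rel (AKRel.braid (q := q) (p := p) (Q := Q) i hi hin)
    simpa only [← freeT_of_lt, map_mul, mkAK_freeT] using h
  comm i j _ hij hj := by
    have h := mkAK_rel (AKRel.comm (q := q) (p := p) (Q := Q) i j hij hj)
    simpa only [← freeT_of_lt, map_mul, mkAK_freeT] using h

theorem AK_isAffineHecke (hq : q ≠ 0) :
    IsAffineHecke n q (Lm K q p Q n) (Tg K q p Q n) := by
  refine AK_isHecke.isAffineHecke hq (fun i hi _ => ?_) (fun j hj hjn => ?_) fun hn => ?_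
  · obtain ⟨i, rfl⟩ : ∃ k, i = k + 1 := ⟨i - 1, by omega⟩
    rw [Lm, Ring.inverse_eq_inv', smul_smul, mul_inv_cancel₀ hq, one_smul]
  · have h := mkAK_rel (AKRel.comm (q := q) (p := p) (Q := Q) 0 j (by omega) hjn)
    simp only [← freeT_of_lt, map_mul, mkAK_freeT] at h
    exact h.symm
  · have h := mkAK_rel (AKRel.braid01 (q := q) (p := p) (Q := Q) hn)
    simp only [← freeT_of_lt, map_mul, mkAK_freeT] at h
    exact h

end Presentation

section Monomials

variable {B C : Type*} [Monoid B] [Monoid C]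

theorem map_monoIn (φ : B →* C) (n : ℕ) (X : ℕ → B) (c : ℕ → ℕ) :
    φ (monoIn n X c) = monoIn n (φ ∘ X) c := by
  simp [monoIn, map_list_prod, Function.comp_def]

theorem monoIn_congr {n : ℕ} {X X' : ℕ → B} {c c' : ℕ → ℕ}
    (hX : ∀ i, 1 ≤ i → i ≤ n → X i = X' i) (hc : ∀ i, 1 ≤ i → i ≤ n → c i = c' i) :
    monoIn n X c = monoIn n X' c' := by
  unfold monoIn
  congr 1
  refine List.map_congr_left fun i hi => ?_
  have := List.mem_range.1 hi
  rw [hX _ (by omega) (by omega), hc _ (by omega) (by omega)]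

theorem TwIn_congr {n : ℕ} {T T' : ℕ → B} (hT : ∀ i, 1 ≤ i → i < n → T i = T' i)
    (w : {w : Equiv.Perm ℕ // IsSnPerm n w}) : TwIn n T w = TwIn n T' w := by
  unfold TwIn
  congr 1
  refine List.map_congr_left fun i hi => ?_
  obtain ⟨h1, h2⟩ := (redWord_spec n w).1 i hi
  exact hT i h1 h2

theorem commute_monoIn {n : ℕ} {X : ℕ → B} {y : B} (h : ∀ i, 1 ≤ i → i ≤ n → Commute y (X i))
    (c : ℕ → ℕ) : Commute y (monoIn n X c) := by
  induction n with
  | zero => simp [monoIn]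
  | succ n ih =>
    rw [monoIn_succ]
    exact (ih fun i h1 h2 => h i h1 (by omega)).mul_right ((h _ (by omega) le_rfl).pow_right _)

end Monomials

section TruncatedMonomials

variable {K B : Type*} [Field K] [Ring B] [Algebra K B] {n : ℕ} {X T : ℕ → B}

theorem monoIn_mul_mem_truncSpan {ℓ r m : ℕ}
    (hX : ∀ i j, 1 ≤ i → i ≤ m → 1 ≤ j → j ≤ m → Commute (X i) (X j)) {c : ℕ → ℕ}
    (hc : ∀ i, 1 ≤ i → i ≤ m → c i < r) {h : B} (hh : h ∈ heckeSpan K n T) :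
    monoIn m X c * h ∈ truncSpan K n X T ℓ r m (∑ i ∈ Finset.Icc 1 m, c i : ℕ) := by
  induction m with
  | zero => simpa [monoIn, truncSpan] using base_mem_polySpan (ℓ := ℓ) (X := X) (m := 0) hh
  | succ m ih =>
    rw [monoIn_succ, ((commute_monoIn (fun i h1 h2 => hX (m + 1) i (by omega) le_rfl h1 (by omega))
      c).pow_left _).symm.eq, mul_assoc]
    refine pow_mul_mem_slices (hc (m + 1) (by omega) le_rfl) ?_
    rw [Finset.sum_Icc_succ_top (by omega), Nat.cast_add, add_sub_cancel_right]
    exact ih (fun i j h1 h2 h3 h4 => hX i j h1 (by omega) h3 (by omega))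
      fun i h1 h2 => hc i h1 (by omega)

theorem truncSpan_le_span_monoIn {ℓ r m : ℕ}
    (hX : ∀ i j, 1 ≤ i → i ≤ m → 1 ≤ j → j ≤ m → Commute (X i) (X j))
    (hH : heckeSpan K n T = Submodule.span K (Set.range (TwIn n T))) (d : ZMod ℓ) :
    truncSpan K n X T ℓ r m d ≤ Submodule.span K {y | ∃ c : ℕ → ℕ, ∃ w,
      (∀ i, 1 ≤ i → i ≤ m → c i < r) ∧ (∀ i, ¬(1 ≤ i ∧ i ≤ m) → c i = 0) ∧
      ((∑ i ∈ Finset.Icc 1 m, c i : ℕ) : ZMod ℓ) = d ∧ y = monoIn m X c * TwIn n T w} := by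
  classical
  induction m generalizing d with
  | zero =>
    refine fun a ha => map_mem_of_mem_polySpan (LinearMap.id) (fun d => Submodule.span K
      {y | ∃ c : ℕ → ℕ, ∃ w, (∀ i, 1 ≤ i → i ≤ 0 → c i < r) ∧ (∀ i, ¬(1 ≤ i ∧ i ≤ 0) → c i = 0) ∧
      ((∑ i ∈ Finset.Icc 1 0, c i : ℕ) : ZMod ℓ) = d ∧ y = monoIn 0 X c * TwIn n T w})
      (fun s hs => ?_) (fun _ k _ _ _ _ => by omega) ha
    rw [hH] at hs
    refine Submodule.span_mono ?_ hs
    rintro _ ⟨w, rfl⟩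
    exact ⟨0, w, fun i _ _ => by omega, fun _ _ => rfl, by simp, by simp [monoIn]⟩
  | succ m ih =>
    refine slices_le fun e he a ha => ?_
    have ha' := ih (fun i j h1 h2 h3 h4 => hX i j h1 (by omega) h3 (by omega)) _ ha
    refine Submodule.span_induction (p := fun a _ => X (m + 1) ^ e * a ∈ _) ?_ (by simp)
      (fun a b _ _ h1 h2 => by rw [mul_add]; exact add_mem h1 h2)
      (fun k a _ h => by rw [mul_smul_comm]; exact Submodule.smul_mem _ _ h) ha'
    rintro _ ⟨c, w, hc, hc0, hcd, rfl⟩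
    have hup : ∀ i, 1 ≤ i → i ≤ m → Function.update c (m + 1) e i = c i := fun i _ hi =>
      Function.update_of_ne (by omega) _ _
    refine Submodule.subset_span ⟨Function.update c (m + 1) e, w, fun i h1 h2 => ?_, fun i hi => ?_,
      ?_, ?_⟩
    · by_cases h : i = m + 1
      · subst h; simpa using he
      · rw [hup i h1 (by omega)]; exact hc i h1 (by omega)
    · rw [Function.update_of_ne (by omega)]
      exact hc0 i (by omega)
    · rw [Finset.sum_Icc_succ_top (by omega), Function.update_self,
        Finset.sum_congr rfl fun i hi => hup i (Finset.mem_Icc.1 hi).1 (Finset.mem_Icc.1 hi).2,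
        Nat.cast_add, hcd, sub_add_cancel]
    · rw [monoIn_succ, Function.update_self, monoIn_congr (fun _ _ _ => rfl) hup, ← mul_assoc,
        ((commute_monoIn (fun i h1 h2 => hX (m + 1) i (by omega) le_rfl h1 (by omega))
          c).pow_left _).eq]

end TruncatedMonomials

section Independence

variable {K : Type} [Field K] {B : Type*} [Ring B] [Algebra K B] {n : ℕ} {q : K} {X T : ℕ → B}

/-- The homomorphism from the free algebra sending the first generator to `X 1` and the others to
the `T i`. -/
def affineRep (K : Type) [Field K] {B : Type*} [Ring B] [Algebra K B] (n : ℕ) (X T : ℕ → B) :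
    FreeAlgebra K (Fin n) →ₐ[K] B :=
  FreeAlgebra.lift K fun i => if i.1 = 0 then X 1 else T i

theorem affineRep_ι_zero (h : 0 < n) : affineRep K n X T (FreeAlgebra.ι K ⟨0, h⟩) = X 1 := by
  simp [affineRep]

theorem affineRep_ι {i : ℕ} (hi : 1 ≤ i) (h : i < n) :
    affineRep K n X T (FreeAlgebra.ι K ⟨i, h⟩) = T i := by
  rw [affineRep, FreeAlgebra.lift_ι_apply, if_neg (by simpa using by omega)]

theorem affineRep_freeT {i : ℕ} (hi : 1 ≤ i) (h : i < n) :
    affineRep K n X T (freeT K n i) = T i := by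
  rw [freeT_of_lt _ h, affineRep_ι hi h]

theorem affineRep_freeL (hA : IsAffineHecke n q X T) (hq : q ≠ 0) {i : ℕ} (hi : 1 ≤ i)
    (hin : i ≤ n) : affineRep K n X T (freeL q n i) = X i := by
  induction i, hi using Nat.le_induction with
  | base => rw [freeL, freeT_of_lt _ (by omega : 0 < n), affineRep_ι_zero]
  | succ i hi ih =>
    obtain ⟨i, rfl⟩ : ∃ k, i = k + 1 := ⟨i - 1, by omega⟩
    rw [freeL, map_smul, map_mul, map_mul, affineRep_freeT hi (by omega), ih (by omega),
      hA.T_X_T _ hi (by omega), smul_smul, inv_mul_cancel₀ hq, one_smul]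

theorem affineRep_mul_mem {N : Submodule K B} (hX : ∀ a ∈ N, X 1 * a ∈ N)
    (hT : ∀ j, 1 ≤ j → j < n → ∀ a ∈ N, T j * a ∈ N) (x : FreeAlgebra K (Fin n)) :
    ∀ a ∈ N, affineRep K n X T x * a ∈ N := by
  induction x using FreeAlgebra.induction with
  | grade0 k =>
    intro a ha
    rw [AlgHom.commutes, ← Algebra.smul_def]
    exact N.smul_mem _ ha
  | grade1 i =>
    intro a ha
    obtain ⟨i, hi⟩ := i
    rcases Nat.eq_zero_or_pos i with rfl | h
    · rw [affineRep_ι_zero]; exact hX a ha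
    · rw [affineRep_ι h]; exact hT i h hi a ha
  | mul x y hx hy =>
    intro a ha
    rw [map_mul, mul_assoc]
    exact hx _ (hy a ha)
  | add x y hx hy =>
    intro a ha
    rw [map_add, add_mul]
    exact N.add_mem (hx a ha) (hy a ha)

/-- Elements of the free algebra are congruent if their images agree as operators from `M` to the
quotient by `J`. -/
def operatorCon {A : Type*} [Ring A] [Algebra K A] (φ : A →ₐ[K] B) (M J : Submodule K B)
    (hM : ∀ x, ∀ a ∈ M, φ x * a ∈ M) (hJ : ∀ x, ∀ a ∈ J, φ x * a ∈ J) : RingCon A where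
  r x y := ∀ a ∈ M, (φ x - φ y) * a ∈ J
  iseqv :=
    { refl := fun x a _ => by simp
      symm := fun h a ha => by
        rw [← neg_sub, neg_mul]
        exact J.neg_mem (h a ha)
      trans := fun h h' a ha => by
        rw [← sub_add_sub_cancel, add_mul]
        exact J.add_mem (h a ha) (h' a ha) }
  add' := fun h h' a ha => by
    rw [map_add, map_add, add_sub_add_comm, add_mul]
    exact J.add_mem (h a ha) (h' a ha)
  mul' := fun {x y z w} h h' a ha => by
    have e : (φ (x * z) - φ (y * w)) * a = (φ x - φ y) * (φ z * a) + φ y * ((φ z - φ w) * a) := by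
      rw [map_mul, map_mul]
      noncomm_ring
    rw [e]
    exact J.add_mem (h _ (hM z a ha)) (hJ y _ (h' a ha))

theorem affineRep_mul_mem_ideal (hA : IsAffineHecke n q X T) (hq : q ≠ 0) (hn : 0 < n) {p t : ℕ}
    {Q : Fin t → K} {x : FreeAlgebra K (Fin n)} (hx : mkAK q p Q n x = 0) {a : B}
    (ha : a ∈ polyMod X n (heckeSpan K n T)) : affineRep K n X T x * a ∈
      IsAffineHecke.idealMod K n X T (Polynomial.aeval (X 1 ^ p) (cycloPoly p Q)) n := by
  set f := Polynomial.aeval (X 1 ^ p) (cycloPoly p Q) with hf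
  have hfa : f ∈ Algebra.adjoin K {X 1} := aeval_cycloPoly_mem_adjoin Q _
  have hM := affineRep_mul_mem (X := X) (T := T) (N := polyMod X n (heckeSpan K n T))
    (fun a ha => mul_mem_polyMod le_rfl hn ha)
    (fun j h1 hj a ha => hA.T_mul_mem_polyMod hq le_rfl h1 hj hj.ne ha)
  have hJ := affineRep_mul_mem (X := X) (T := T) (N := IsAffineHecke.idealMod K n X T f n)
    (fun a ha => mul_mem_polyMod le_rfl hn ha)
    (fun j h1 hj a ha => hA.T_mul_mem_ideal hq hfa le_rfl h1 hj hj.ne ha)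
  let c := operatorCon (affineRep K n X T) _ _ hM hJ
  have hc : ∀ ⦃y z⦄, AKRel K q p Q n y z → c.mkₐ K y = c.mkₐ K z := by
    intro y z h
    refine (RingCon.eq c).2 ?_
    cases h with
    | cyclo h0 =>
      intro a ha
      rw [← aeval_cycloPoly, ← Polynomial.aeval_algHom_apply, map_pow, affineRep_ι_zero, map_zero,
        sub_zero]
      exact hA.conjSeq_mul_mem_ideal hq hfa le_rfl hn (i := 0) ha
    | braid01 h1 =>
      intro a _
      have e : X 1 * T 1 * X 1 * T 1 = T 1 * X 1 * T 1 * X 1 := by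
        have h := congrArg (q • ·) (hA.comm_X 1 2 le_rfl (by omega) (by omega) (by omega))
        rw [← mul_smul_comm, ← smul_mul_assoc, ← hA.T_X_T 1 le_rfl h1] at h
        simpa only [mul_assoc] using h
      simp only [map_mul, affineRep_ι_zero, affineRep_ι le_rfl, e, sub_self, zero_mul]
      exact zero_mem _
    | quad i hi hin =>
      intro a _
      have e : (T i + 1) * (T i - algebraMap K B q) = 0 := by
        rw [add_mul, mul_sub, hA.quad i hi hin, Algebra.algebraMap_eq_smul_one]
        simp only [mul_smul_comm, mul_one, one_mul]
        module
      simp only [map_mul, map_add, map_sub, map_one, map_zero, affineRep_ι hi, AlgHom.commutes, e,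
        sub_self, zero_mul]
      exact zero_mem _
    | braid i hi hin =>
      intro a _
      simp only [map_mul, affineRep_ι hi, affineRep_ι (show 1 ≤ i + 1 by omega), hA.braid i hi hin,
        sub_self, zero_mul]
      exact zero_mem _
    | comm i j hij hj =>
      intro a _
      have e : affineRep K n X T (FreeAlgebra.ι K ⟨i, by omega⟩) * T j =
          T j * affineRep K n X T (FreeAlgebra.ι K ⟨i, by omega⟩) := by
        rcases Nat.eq_zero_or_pos i with rfl | hi
        · rw [affineRep_ι_zero]
          exact (hA.comm_T j 1 (by omega) hj le_rfl hn (by omega) (by omega)).symm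
        · rw [affineRep_ι hi]
          exact hA.comm i j hi hij hj
      rw [map_mul, map_mul, affineRep_ι (by omega) hj, e, sub_self, zero_mul]
      exact zero_mem _
  have hx' : c.mkₐ K x = 0 := by
    have h := RingQuot.liftAlgHom_mkAlgHom_apply K (c.mkₐ K) hc x
    rw [← h, show RingQuot.mkAlgHom K (AKRel K q p Q n) x = 0 from hx, map_zero]
  have h : c x 0 := (RingCon.eq c).1 hx'
  simpa using h a ha

theorem linearIndependent_Lm_mul_TwIn (hq : q ≠ 0) (hn : 0 < n) {p t : ℕ} (hp : 0 < p) (ht : 0 < t)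
    (Q : Fin t → K) : LinearIndependent K
      fun cw : {c : ℕ → ℕ // (∀ i, 1 ≤ i → i ≤ n → c i < p * t) ∧
          ∀ i, ¬(1 ≤ i ∧ i ≤ n) → c i = 0} × {w // IsSnPerm n w} =>
        monoIn n (Lm K q p Q n) cw.1.1 * TwIn n (Tg K q p Q n) cw.2 := by
  obtain ⟨X, T, hA, hF, hli⟩ := exists_affineHecke_model q hn
  have hli' := hli.comp (fun cw : {c : ℕ → ℕ // (∀ i, 1 ≤ i → i ≤ n → c i < p * t) ∧
      ∀ i, ¬(1 ≤ i ∧ i ≤ n) → c i = 0} × {w // IsSnPerm n w} => (⟨cw.1.1, cw.1.2.2⟩, cw.2))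
    (by rintro ⟨⟨c, hc⟩, w⟩ ⟨⟨c', hc'⟩, w'⟩ h; simpa using h)
  rw [linearIndependent_iff'] at hli' ⊢
  intro s g hg
  refine hli' s g ?_
  set x : FreeAlgebra K (Fin n) := ∑ cw ∈ s, g cw •
    (monoIn n (freeL q n) cw.1.1 * TwIn n (freeT K n) cw.2) with hx
  have hx0 : mkAK q p Q n x = 0 := by
    rw [hx, ← hg, map_sum]
    refine Finset.sum_congr rfl fun cw _ => ?_
    rw [map_smul, map_mul, ← AlgHom.coe_toMonoidHom, map_monoIn, map_TwIn]
    congr 2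
    · exact monoIn_congr (fun i _ _ => mkAK_freeL q p Q n i) fun _ _ _ => rfl
    · exact TwIn_congr (fun i _ _ => mkAK_freeT q p Q n i) _
  have hxφ : affineRep K n X T x = ∑ cw ∈ s, g cw • (monoIn n X cw.1.1 * TwIn n T cw.2) := by
    rw [hx, map_sum]
    refine Finset.sum_congr rfl fun cw _ => ?_
    rw [map_smul, map_mul, ← AlgHom.coe_toMonoidHom, map_monoIn, map_TwIn]
    congr 2
    · exact monoIn_congr (fun i h1 h2 => affineRep_freeL hA hq h1 h2) fun _ _ _ => rfl
    · exact TwIn_congr (fun i h1 h2 => affineRep_freeT h1 h2) _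
  have hz' := affineRep_mul_mem_ideal hA hq hn hx0
    (base_mem_polyMod (X := X) (m := n) (one_mem_heckeSpan n T))
  rw [mul_one] at hz'
  simp only [Function.comp_apply]
  rw [← hxφ]
  refine hA.eq_zero_of_mem_truncSpan_of_mem_ideal hq (aeval_cycloPoly_mem_adjoin Q _)
    (Nat.mul_pos hp ht) ?_ hF le_rfl (d := 0) ?_ hz'
  · have h := aeval_cycloPoly_sub_mem_slices Q hp (ℓ := 1) (Subsingleton.elim _ _) n X T
    simpa only [polySpan_one] using h
  · rw [hxφ]
    refine Submodule.sum_mem _ fun cw _ => Submodule.smul_mem _ _ ?_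
    have h := monoIn_mul_mem_truncSpan (K := K) (T := T) (ℓ := 1) (r := p * t) (m := n)
      (fun i j h1 h2 h3 h4 => hA.commute_X h1 h2 h3 h4) cw.1.2.1 (TwIn_mem_heckeSpan cw.2)
    rwa [Subsingleton.elim (0 : ZMod 1)]

theorem AK_heckeSpan_eq (hq : q ≠ 0) (hn : 0 < n) {p t : ℕ} (hp : 0 < p) (ht : 0 < t)
    (Q : Fin t → K) : heckeSpan K n (Tg K q p Q n) =
      Submodule.span K (Set.range (TwIn n (Tg K q p Q n))) := by
  have h := (linearIndependent_Lm_mul_TwIn hq hn hp ht Q).comp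
    (fun w : {w // IsSnPerm n w} => (⟨0, fun _ _ _ => Nat.mul_pos hp ht, fun _ _ => rfl⟩, w))
    fun w w' h => (Prod.ext_iff.1 h).2
  refine AK_isHecke.heckeSpan_eq hn ?_
  convert h using 1
  funext w
  simp [monoIn]

end Independence

section Spanning

variable {K : Type} [Field K] {q : K} {p t : ℕ} {Q : Fin t → K} {n : ℕ}

theorem Tg_mem_AKp {i : ℕ} (hi : 1 ≤ i) (hin : i < n) : Tg K q p Q n i ∈ AKp K q p Q n :=
  Algebra.subset_adjoin (Or.inr ⟨i, hi, hin, rfl⟩)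

theorem Tg_zero_pow_mem_AKp : Tg K q p Q n 0 ^ p ∈ AKp K q p Q n :=
  Algebra.subset_adjoin (Or.inl (Or.inl rfl))

theorem inverse_mul_Tg_mul_mem_AKp :
    Ring.inverse (Tg K q p Q n 0) * Tg K q p Q n 1 * Tg K q p Q n 0 ∈ AKp K q p Q n :=
  Algebra.subset_adjoin (Or.inl (Or.inr rfl))

theorem TwIn_mem_AKp (w : {w // IsSnPerm n w}) : TwIn n (Tg K q p Q n) w ∈ AKp K q p Q n := by
  refine Subalgebra.list_prod_mem _ fun x hx => ?_
  obtain ⟨i, hi, rfl⟩ := List.mem_map.1 hx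
  exact Tg_mem_AKp ((redWord_spec n w).1 i hi).1 ((redWord_spec n w).1 i hi).2

theorem exists_inverse_Tg_zero (hp : 0 < p) (hQ : ∀ k, Q k ≠ 0) (hn : 0 < n) :
    ∃ g : Polynomial K, Tg K q p Q n 0 * Ring.inverse (Tg K q p Q n 0) = 1 ∧
      Ring.inverse (Tg K q p Q n 0) =
        Tg K q p Q n 0 ^ (p - 1) * Polynomial.aeval (Tg K q p Q n 0 ^ p) g := by
  obtain ⟨g, hg⟩ := exists_inverse_of_aeval_cycloPoly Q hp hQ (aeval_Tg_zero (q := q) hn)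
  set y := Tg K q p Q n 0
  have hc : Commute y (y ^ (p - 1) * Polynomial.aeval (y ^ p) g) := by
    clear hg
    refine (Commute.pow_right rfl _).mul_right ?_
    induction g using Polynomial.induction_on' with
    | add f g hf hg => rw [map_add]; exact hf.add_right hg
    | monomial k c =>
      rw [Polynomial.aeval_monomial]
      exact (Algebra.commute_algebraMap_right c y).mul_right ((Commute.pow_right rfl _).pow_right _)
  let u : (AK K q p Q n)ˣ := ⟨y, _, hg, hc.symm.eq.trans hg⟩
  have hu : Ring.inverse y = y ^ (p - 1) * Polynomial.aeval (y ^ p) g := Ring.inverse_unit u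
  exact ⟨g, by rw [hu, hg], hu⟩

theorem exists_Tg_zero_mul_eq (hq : q ≠ 0) (hp : 0 < p) (hQ : ∀ k, Q k ≠ 0) (hn : 1 < n)
    {x : AK K q p Q n} (hx : x ∈ AKp K q p Q n) :
    ∃ x' ∈ AKp K q p Q n, Tg K q p Q n 0 * x = x' * Tg K q p Q n 0 := by
  have hA := AK_isAffineHecke (p := p) (Q := Q) (n := n) hq
  obtain ⟨-, hinv, -⟩ := exists_inverse_Tg_zero (q := q) hp hQ (by omega : 0 < n)
  refine Algebra.adjoin_induction (p := fun x _ => ∃ x' ∈ AKp K q p Q n,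
    Tg K q p Q n 0 * x = x' * Tg K q p Q n 0) (fun x hx => ?_)
    (fun k => ⟨_, Subalgebra.algebraMap_mem _ k, (Algebra.commutes _ _).symm⟩)
    (fun x y _ _ ⟨x', hx, ex⟩ ⟨y', hy, ey⟩ => ⟨x' + y', add_mem hx hy, by
      rw [mul_add, ex, ey, add_mul]⟩)
    (fun x y _ _ ⟨x', hx, ex⟩ ⟨y', hy, ey⟩ => ⟨x' * y', mul_mem hx hy, by
      rw [← mul_assoc, ex, mul_assoc, ey, mul_assoc]⟩) hx
  set y := Tg K q p Q n 0 with hy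
  set s := Tg K q p Q n 1 with hs
  have hsA : s ∈ AKp K q p Q n := Tg_mem_AKp le_rfl hn
  rcases hx with (rfl | rfl) | ⟨i, hi, hin, rfl⟩
  · exact ⟨_, Tg_zero_pow_mem_AKp, (Commute.pow_right rfl _).eq⟩
  · exact ⟨s, hsA, by rw [← mul_assoc, ← mul_assoc, hinv, one_mul]⟩
  · rcases hi.eq_or_lt with rfl | hi
    · have hquad : s * s = (q - 1) • s + q • (1 : AK K q p Q n) := hA.quad 1 le_rfl hn
      have hss : (q⁻¹ • (s - (q - 1) • 1)) * s = 1 := by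
        rw [smul_mul_assoc, sub_mul, hquad, smul_one_mul, add_sub_cancel_left, smul_smul,
          inv_mul_cancel₀ hq, one_smul]
      have hbraid : y * s * y * s = s * y * s * y := by
        have h := mkAK_rel (AKRel.braid01 (q := q) (p := p) (Q := Q) hn)
        simp only [← freeT_of_lt, map_mul, mkAK_freeT] at h
        exact h
      have hconj : s * y * s = Ring.inverse y * s * y * s * y := by
        have hu : IsUnit y := by
          by_contra h
          rw [Ring.inverse_non_unit _ h, mul_zero] at hinv
          have : Subsingleton (AK K q p Q n) := subsingleton_of_zero_eq_one hinv
          exact h (isUnit_of_subsingleton _)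
        refine hu.mul_left_cancel ?_
        simp only [← mul_assoc]
        rw [hinv, one_mul, hbraid]
      refine ⟨q⁻¹ • (s - (q - 1) • 1) * (Ring.inverse y * s * y) * s,
        mul_mem (mul_mem (Subalgebra.smul_mem _ (sub_mem hsA
          (Subalgebra.smul_mem _ (one_mem _) _)) _) inverse_mul_Tg_mul_mem_AKp) hsA, ?_⟩
      calc y * s = (q⁻¹ • (s - (q - 1) • 1)) * s * (y * s) := by rw [hss, one_mul]
        _ = (q⁻¹ • (s - (q - 1) • 1)) * (s * y * s) := by simp only [mul_assoc]
        _ = _ := by rw [hconj]; simp only [mul_assoc]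
    · exact ⟨_, Tg_mem_AKp (by omega) hin,
        (hA.comm_T i 1 (by omega) hin le_rfl (by omega) (by omega) (by omega)).symm⟩

/-- The translates of `AKp` by powers of `T_0` are multiplied as in a graded algebra. -/
theorem mul_mem_AKp_mul_pow (hq : q ≠ 0) (hp : 0 < p) (hQ : ∀ k, Q k ≠ 0) (hn : 1 < n)
    {a b : AK K q p Q n} {d e : ℕ} (ha : ∃ x ∈ AKp K q p Q n, a = x * Tg K q p Q n 0 ^ d)
    (hb : ∃ x ∈ AKp K q p Q n, b = x * Tg K q p Q n 0 ^ e) :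
    ∃ x ∈ AKp K q p Q n, a * b = x * Tg K q p Q n 0 ^ (d + e) := by
  have key : ∀ d : ℕ, ∀ x ∈ AKp K q p Q n, ∃ x' ∈ AKp K q p Q n,
      Tg K q p Q n 0 ^ d * x = x' * Tg K q p Q n 0 ^ d := by
    intro d
    induction d with
    | zero => exact fun x hx => ⟨x, hx, by simp⟩
    | succ d ih =>
      intro x hx
      obtain ⟨x₁, h₁, e₁⟩ := exists_Tg_zero_mul_eq hq hp hQ hn hx
      obtain ⟨x₂, h₂, e₂⟩ := ih x₁ h₁
      exact ⟨x₂, h₂, by rw [pow_succ, mul_assoc, e₁, ← mul_assoc, e₂, mul_assoc]⟩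
  obtain ⟨x, hx, rfl⟩ := ha
  obtain ⟨y, hy, rfl⟩ := hb
  obtain ⟨z, hz, ez⟩ := key d y hy
  exact ⟨x * z, mul_mem hx hz, by
    rw [mul_assoc, ← mul_assoc _ y, ez, pow_add]
    simp only [mul_assoc]⟩

theorem Lm_mem_AKp_mul (hq : q ≠ 0) (hp : 0 < p) (hQ : ∀ k, Q k ≠ 0) (hn : 1 < n) {k : ℕ}
    (hk : 1 ≤ k) (hkn : k ≤ n) :
    ∃ x ∈ AKp K q p Q n, Lm K q p Q n k = x * Tg K q p Q n 0 ^ 1 := by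
  induction k, hk using Nat.le_induction with
  | base => exact ⟨1, one_mem _, by rw [one_mul, pow_one]; rfl⟩
  | succ k hk ih =>
    obtain ⟨k, rfl⟩ : ∃ j, k = j + 1 := ⟨k - 1, by omega⟩
    have hT : ∃ x ∈ AKp K q p Q n, Tg K q p Q n (k + 1) = x * Tg K q p Q n 0 ^ 0 :=
      ⟨_, Tg_mem_AKp hk (by omega), by simp⟩
    obtain ⟨x, hx, e⟩ := mul_mem_AKp_mul_pow hq hp hQ hn
      (mul_mem_AKp_mul_pow hq hp hQ hn hT (ih (by omega))) hT
    exact ⟨Ring.inverse q • x, Subalgebra.smul_mem _ hx _, by rw [Lm, e, smul_mul_assoc]⟩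

theorem monoIn_Lm_mem_AKp_mul (hq : q ≠ 0) (hp : 0 < p) (hQ : ∀ k, Q k ≠ 0) (hn : 1 < n)
    (c : ℕ → ℕ) {m : ℕ} (hm : m ≤ n) : ∃ x ∈ AKp K q p Q n,
      monoIn m (Lm K q p Q n) c = x * Tg K q p Q n 0 ^ ∑ i ∈ Finset.Icc 1 m, c i := by
  induction m with
  | zero => exact ⟨1, one_mem _, by simp [monoIn]⟩
  | succ m ih =>
    rw [monoIn_succ, Finset.sum_Icc_succ_top (by omega)]
    refine mul_mem_AKp_mul_pow hq hp hQ hn (ih (by omega)) ?_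
    generalize c (m + 1) = e
    induction e with
    | zero => exact ⟨1, one_mem _, by simp⟩
    | succ e ih =>
      rw [pow_succ]
      exact mul_mem_AKp_mul_pow hq hp hQ hn ih (Lm_mem_AKp_mul hq hp hQ hn (by omega) hm)

theorem monoIn_Lm_mem_AKp (hq : q ≠ 0) (hp : 0 < p) (hQ : ∀ k, Q k ≠ 0) (hn : 1 < n)
    {c : ℕ → ℕ} (hc : p ∣ ∑ i ∈ Finset.Icc 1 n, c i) :
    monoIn n (Lm K q p Q n) c ∈ AKp K q p Q n := by
  obtain ⟨x, hx, e⟩ := monoIn_Lm_mem_AKp_mul hq hp hQ hn c le_rfl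
  obtain ⟨k, hk⟩ := hc
  rw [e, hk, pow_mul]
  exact mul_mem hx (pow_mem Tg_zero_pow_mem_AKp k)

theorem AKp_mul_mem_polySpan (hq : q ≠ 0) (hp : 0 < p) (hQ : ∀ k, Q k ≠ 0) (hn : 1 < n)
    {x : AK K q p Q n} (hx : x ∈ AKp K q p Q n) (d : ZMod p) :
    ∀ a ∈ polySpan p (Lm K q p Q n) n (heckeSpan K n (Tg K q p Q n)) d,
      x * a ∈ polySpan p (Lm K q p Q n) n (heckeSpan K n (Tg K q p Q n)) d := by
  have hA := AK_isAffineHecke (p := p) (Q := Q) (n := n) hq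
  obtain ⟨g, -, hinv⟩ := exists_inverse_Tg_zero (q := q) hp hQ (by omega : 0 < n)
  have hT : ∀ i, 1 ≤ i → i < n → ∀ d : ZMod p,
      ∀ a ∈ polySpan p (Lm K q p Q n) n (heckeSpan K n (Tg K q p Q n)) d,
      Tg K q p Q n i * a ∈ polySpan p (Lm K q p Q n) n (heckeSpan K n (Tg K q p Q n)) d :=
    fun i hi hin d a ha => hA.T_mul_mem hq le_rfl hi hin hin.ne ha
  have hpow : ∀ e : ℕ, ∀ d d' : ZMod p, d' = d + e →
      ∀ a ∈ polySpan p (Lm K q p Q n) n (heckeSpan K n (Tg K q p Q n)) d,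
      Tg K q p Q n 0 ^ e * a ∈ polySpan p (Lm K q p Q n) n (heckeSpan K n (Tg K q p Q n)) d' :=
    fun e d d' h a ha => pow_mul_mem_polySpan (X := Lm K q p Q n) le_rfl (by omega : 1 ≤ n) e h ha
  have hg : ∀ d : ZMod p, ∀ a ∈ polySpan p (Lm K q p Q n) n (heckeSpan K n (Tg K q p Q n)) d,
      Polynomial.aeval (Tg K q p Q n 0 ^ p) g * a ∈
        polySpan p (Lm K q p Q n) n (heckeSpan K n (Tg K q p Q n)) d := by
    clear hinv
    intro d a ha
    induction g using Polynomial.induction_on' with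
    | add f g hf hg => rw [map_add, add_mul]; exact add_mem hf hg
    | monomial k c =>
      rw [Polynomial.aeval_monomial, ← Algebra.smul_def, smul_mul_assoc, ← pow_mul]
      exact Submodule.smul_mem _ _ (hpow _ d d (by simp) a ha)
  refine Algebra.adjoin_induction (p := fun x _ =>
    ∀ a ∈ polySpan p (Lm K q p Q n) n (heckeSpan K n (Tg K q p Q n)) d,
      x * a ∈ polySpan p (Lm K q p Q n) n (heckeSpan K n (Tg K q p Q n)) d) (fun x hx => ?_)
    (fun k a ha => by rw [← Algebra.smul_def]; exact Submodule.smul_mem _ _ ha)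
    (fun x y _ _ hx hy a ha => by rw [add_mul]; exact add_mem (hx a ha) (hy a ha))
    (fun x y _ _ hx hy a ha => by rw [mul_assoc]; exact hx _ (hy a ha)) hx
  intro a ha
  rcases hx with (rfl | rfl) | ⟨i, hi, hin, rfl⟩
  · exact hpow p d d (by simp) a ha
  · rw [mul_assoc, mul_assoc, hinv, mul_assoc]
    refine hpow (p - 1) (d + 1) d ?_ _ (hg _ _ (hT 1 le_rfl hn _ _ ?_))
    · rw [Nat.cast_sub hp]; simp
    · simpa using hpow 1 d (d + 1) (by simp) a ha
  · exact hT i hi hin d a ha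

theorem AKp_le_span (hq : q ≠ 0) (hp : 0 < p) (ht : 0 < t) (hQ : ∀ k, Q k ≠ 0) (hn : 1 < n) :
    Subalgebra.toSubmodule (AKp K q p Q n) ≤ Submodule.span K {y | ∃ c : ℕ → ℕ, ∃ w,
      (∀ i, 1 ≤ i → i ≤ n → c i < p * t) ∧ (∀ i, ¬(1 ≤ i ∧ i ≤ n) → c i = 0) ∧
      ((∑ i ∈ Finset.Icc 1 n, c i : ℕ) : ZMod p) = 0 ∧
      y = monoIn n (Lm K q p Q n) c * TwIn n (Tg K q p Q n) w} := by
  intro x hx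
  have hA := AK_isAffineHecke (p := p) (Q := Q) (n := n) hq
  have h := AKp_mul_mem_polySpan hq hp hQ hn ((Subalgebra.mem_toSubmodule _).1 hx) 0 1
    (base_mem_polySpan (one_mem_heckeSpan n _))
  rw [mul_one] at h
  refine truncSpan_le_span_monoIn (fun i j h1 h2 h3 h4 => hA.commute_X h1 h2 h3 h4)
    (AK_heckeSpan_eq hq (by omega) hp ht Q) 0 ?_
  exact hA.polySpan_le_truncSpan hq (Nat.mul_pos hp ht) (by simp)
    (aeval_cycloPoly_sub_mem_slices Q hp (by simp) n (Lm K q p Q n) _)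
    (aeval_Tg_zero (by omega)) n le_rfl 0 h

end Spanning

end HuMathas

open HuMathas in
/-- **Statement 9** (Lemma `Hrpn basis`).  The cyclotomic Hecke algebra `H_{r,p,n}(Q)` of type
`G(r,p,n)` has `K`-basis
`{L_1^{c_1} ⋯ L_n^{c_n} T_w : w ∈ S_n, 0 ≤ c_i < r, c_1 + ⋯ + c_n ≡ 0 (mod p)}`. -/
theorem AKp_basis
    (K : Type) [Field K] [IsAlgClosed K]
    (p t n : ℕ) (hp : 1 < p) (hn : 3 ≤ n) (ht : 0 < t)
    (ε q : K) (hε : IsPrimitiveRoot ε p) (hq : q ≠ 0)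
    (Q : Fin t → K) (hQ : ∀ i, Q i ≠ 0) :
    LinearIndependent K
      (fun cw : {cw : (ℕ → ℕ) × Equiv.Perm ℕ //
          (∀ i : ℕ, 1 ≤ i → i ≤ n → cw.1 i < p * t) ∧
          (∀ i : ℕ, ¬(1 ≤ i ∧ i ≤ n) → cw.1 i = 0) ∧
          (∑ i ∈ Finset.Icc 1 n, cw.1 i) % p = 0 ∧ IsSnPerm n cw.2} =>
        Lmono K q p Q n cw.1.1 * Tw K q p Q n cw.1.2) ∧
    Submodule.span K
      (Set.range (fun cw : {cw : (ℕ → ℕ) × Equiv.Perm ℕ //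
          (∀ i : ℕ, 1 ≤ i → i ≤ n → cw.1 i < p * t) ∧
          (∀ i : ℕ, ¬(1 ≤ i ∧ i ≤ n) → cw.1 i = 0) ∧
          (∑ i ∈ Finset.Icc 1 n, cw.1 i) % p = 0 ∧ IsSnPerm n cw.2} =>
        Lmono K q p Q n cw.1.1 * Tw K q p Q n cw.1.2)) =
      Subalgebra.toSubmodule (AKp K q p Q n) := by
  have hp0 : 0 < p := by omega
  constructor
  · have h := (linearIndependent_Lm_mul_TwIn hq (by omega : 0 < n) hp0 ht Q).comp
      (fun cw : {cw : (ℕ → ℕ) × Equiv.Perm ℕ //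
          (∀ i : ℕ, 1 ≤ i → i ≤ n → cw.1 i < p * t) ∧
          (∀ i : ℕ, ¬(1 ≤ i ∧ i ≤ n) → cw.1 i = 0) ∧
          (∑ i ∈ Finset.Icc 1 n, cw.1 i) % p = 0 ∧ IsSnPerm n cw.2} =>
        (⟨cw.1.1, cw.2.1, cw.2.2.1⟩, ⟨cw.1.2, cw.2.2.2.2⟩))
      (by rintro ⟨⟨c, w⟩, h⟩ ⟨⟨c', w'⟩, h'⟩ e; simpa using e)
    convert h using 1
    funext cw
    exact congrArg (Lmono K q p Q n cw.1.1 * ·) (Tw_eq_TwIn q p Q n ⟨cw.1.2, cw.2.2.2.2⟩)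
  · refine le_antisymm (Submodule.span_le.2 ?_)
      ((AKp_le_span hq hp0 ht hQ (by omega)).trans (Submodule.span_mono ?_))
    · rintro _ ⟨⟨⟨c, w⟩, -, -, hc, hw⟩, rfl⟩
      refine (AKp K q p Q n).mul_mem
        (monoIn_Lm_mem_AKp hq hp0 hQ (by omega) (Nat.dvd_of_mod_eq_zero hc)) ?_
      rw [Tw_eq_TwIn q p Q n ⟨w, hw⟩]
      exact TwIn_mem_AKp _
    · rintro _ ⟨c, w, hc, hc0, hcp, rfl⟩
      refine ⟨⟨(c, w), hc, hc0, Nat.mod_eq_zero_of_dvd ((ZMod.natCast_eq_zero_iff _ _).1 hcp),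
        w.2⟩, ?_⟩
      exact congrArg (Lmono K q p Q n c * ·) (Tw_eq_TwIn q p Q n w)
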